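/- arXiv:1705.08617 — 9 statements merged into one kernel-verified Lean document; each statement's English description precedes it below -/
import Mathlib

section
/- Let q > 1, χ > 0 and u ∈ ℝ with u ≠ 0. Then the function v ↦ η_q(v; χ) is differentiable at u, its derivative equals d = 1 / (1 + χ·q·(q−1)·|η_q(u; χ)|^{q−2}), and this derivative satisfies 0 < d ≤ 1. -/
/-- The proximal operator `η_q(u; χ)`, i.e. the (unique, for `q ≥ 1`, `χ > 0`) global
minimizer over `z ∈ ℝ` of `z ↦ (1/2)(u − z)² + χ|z|^q`. -/
noncomputable def prox (q χ u : ℝ) : ℝ :=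
  Classical.epsilon fun z : ℝ =>
    ∀ w : ℝ, (1 / 2) * (u - z) ^ 2 + χ * |z| ^ q ≤ (1 / 2) * (u - w) ^ 2 + χ * |w| ^ q

/-- The map `z ↦ |z|^(q-2) z` is monotone for `q > 1`. -/
theorem monotone_abs_rpow_sub_two_mul {q : ℝ} (hq : 1 < q) :
    Monotone fun z : ℝ => |z| ^ (q - 2) * z := by
  have key : ∀ z : ℝ, 0 ≤ z → |z| ^ (q - 2) * z = z ^ (q - 1) := by
    intro z hz
    rcases hz.eq_or_lt with rfl | hz
    · simp [Real.zero_rpow (sub_pos.2 hq).ne']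
    · rw [abs_of_pos hz, ← Real.rpow_add_one hz.ne']
      congr 1
      ring
  have mono : ∀ a b : ℝ, 0 ≤ a → a ≤ b → |a| ^ (q - 2) * a ≤ |b| ^ (q - 2) * b := by
    intro a b ha hab
    rw [key a ha, key b (ha.trans hab)]
    exact Real.rpow_le_rpow ha hab (sub_pos.2 hq).le
  intro a b hab
  rcases le_total 0 a with ha | ha
  · exact mono a b ha hab
  · rcases le_total 0 b with hb | hb
    · exact (mul_nonpos_of_nonneg_of_nonpos (by positivity) ha).trans (by positivity)
    · have := mono (-b) (-a) (by linarith) (by linarith)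
      simp only [abs_neg] at this
      linarith

theorem hasDerivAt_abs_rpow_sub_two_mul (q : ℝ) {z : ℝ} (hz : z ≠ 0) :
    HasDerivAt (fun z : ℝ => |z| ^ (q - 2) * z) ((q - 1) * |z| ^ (q - 2)) z := by
  have h := ((hasDerivAt_abs hz).rpow_const (p := q - 2) (Or.inl (abs_ne_zero.2 hz))).mul
    (hasDerivAt_id z)
  refine h.congr_deriv ?_
  have h1 : |z| ^ (q - 2) = |z| ^ (q - 2 - 1) * |z| := by
    rw [← Real.rpow_add_one (abs_ne_zero.2 hz)]
    congr 1
    ring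
  have h2 : (SignType.sign z : ℝ) * z = |z| := sign_mul_self z
  simp only [id, mul_one]
  rw [h1]
  linear_combination (q - 2) * |z| ^ (q - 2 - 1) * h2

/-- The objective defining `prox q χ u` attains its minimum at `prox q χ u`. -/
theorem prox_isMin {q χ : ℝ} (hq : 1 < q) (hχ : 0 < χ) (u w : ℝ) :
    (1 / 2) * (u - prox q χ u) ^ 2 + χ * |prox q χ u| ^ q ≤
      (1 / 2) * (u - w) ^ 2 + χ * |w| ^ q := by
  have hex : ∃ z : ℝ, ∀ w : ℝ, (1 / 2) * (u - z) ^ 2 + χ * |z| ^ q ≤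
      (1 / 2) * (u - w) ^ 2 + χ * |w| ^ q := by
    have hc : Continuous fun z : ℝ => (1 / 2) * (u - z) ^ 2 + χ * |z| ^ q := by
      have : Continuous fun z : ℝ => |z| ^ q :=
        continuous_abs.rpow_const fun _ => Or.inr (by linarith)
      fun_prop
    refine hc.exists_forall_le' 0 ?_
    filter_upwards [(isCompact_closedBall (0 : ℝ) (2 * |u|)).compl_mem_cocompact] with z hz
    have hz' : 2 * |u| < |z| := by simpa using hz
    have h1 : |u| ≤ |u - z| := by
      have := abs_sub_abs_le_abs_sub z u
      rw [abs_sub_comm] at this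
      linarith
    have h2 : u ^ 2 ≤ (u - z) ^ 2 := sq_le_sq.2 h1
    have h3 : 0 ≤ χ * |z| ^ q := by positivity
    rw [abs_zero, Real.zero_rpow (by linarith)]
    linarith
  exact Classical.epsilon_spec hex w

/-- First-order optimality condition for the proximal operator. -/
theorem prox_stationary {q χ : ℝ} (hq : 1 < q) (hχ : 0 < χ) (u : ℝ) :
    prox q χ u + χ * q * (|prox q χ u| ^ (q - 2) * prox q χ u) = u := by
  have hmin : IsLocalMin (fun z : ℝ => (1 / 2) * (u - z) ^ 2 + χ * |z| ^ q) (prox q χ u) :=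
    Filter.Eventually.of_forall (prox_isMin hq hχ u)
  have hd := ((((hasDerivAt_id (prox q χ u)).const_sub u).pow 2).const_mul (1 / 2)).add
    ((hasDerivAt_abs_rpow (prox q χ u) hq).const_mul χ)
  have h0 := hmin.hasDerivAt_eq_zero hd
  simp only [id] at h0
  norm_num at h0
  linarith

theorem abs_prox_sub_prox_le {q χ : ℝ} (hq : 1 < q) (hχ : 0 < χ) (u v : ℝ) :
    |prox q χ u - prox q χ v| ≤ |u - v| := by
  wlog h : prox q χ v ≤ prox q χ u generalizing u v
  · rw [abs_sub_comm, abs_sub_comm u]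
    exact this v u (le_of_not_ge h)
  have hm := mul_le_mul_of_nonneg_left (monotone_abs_rpow_sub_two_mul hq h)
    (show 0 ≤ χ * q by positivity)
  have hu := prox_stationary hq hχ u
  have hv := prox_stationary hq hχ v
  rw [abs_of_nonneg (sub_nonneg.2 h)]
  refine le_trans ?_ (le_abs_self _)
  simp only at hm
  linarith

theorem continuous_prox {q χ : ℝ} (hq : 1 < q) (hχ : 0 < χ) : Continuous (prox q χ) :=
  (LipschitzWith.of_dist_le_mul (K := 1) fun u v => by
    simpa [Real.dist_eq] using abs_prox_sub_prox_le hq hχ u v).continuous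

/-- For `q > 1`, `χ > 0` and `u ≠ 0`, the map `v ↦ η_q(v; χ)` is
differentiable at `u` with derivative `d = 1/(1 + χ q (q−1) |η_q(u;χ)|^{q−2})`, and
`0 < d ≤ 1`. -/
theorem stmt_3 (q χ u : ℝ) (hq : 1 < q) (hχ : 0 < χ) (hu : u ≠ 0) :
    HasDerivAt (fun v => prox q χ v)
      (1 / (1 + χ * q * (q - 1) * |prox q χ u| ^ (q - 2))) u ∧
    0 < 1 / (1 + χ * q * (q - 1) * |prox q χ u| ^ (q - 2)) ∧
    1 / (1 + χ * q * (q - 1) * |prox q χ u| ^ (q - 2)) ≤ 1 := by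
  have hq1 : 0 < q - 1 := sub_pos.2 hq
  have hnn : 0 ≤ χ * q * (q - 1) * |prox q χ u| ^ (q - 2) := by positivity
  have hpos : 0 < 1 + χ * q * (q - 1) * |prox q χ u| ^ (q - 2) := by linarith
  refine ⟨?_, by positivity, (div_le_one hpos).2 (by linarith)⟩
  have hne : prox q χ u ≠ 0 := by
    intro h
    have := prox_stationary hq hχ u
    simp only [h, mul_zero, add_zero] at this
    exact hu this.symm
  have hG : HasDerivAt (fun z : ℝ => z + χ * q * (|z| ^ (q - 2) * z))
      (1 + χ * q * (q - 1) * |prox q χ u| ^ (q - 2)) (prox q χ u) :=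
    ((hasDerivAt_id _).add ((hasDerivAt_abs_rpow_sub_two_mul q hne).const_mul (χ * q))).congr_deriv
      (by ring)
  rw [one_div]
  exact hG.of_local_left_inverse (continuous_prox hq hχ).continuousAt hpos.ne'
    (Filter.Eventually.of_forall (prox_stationary hq hχ))
end

section
/- Let 1 < q < 2 and χ > 0. Then |u| / |η_q(u; χ)| → 1 as u → +∞. -/
open Filter

theorem prox_isMinimizer {q χ : ℝ} (hq : 0 ≤ q) (hχ : 0 ≤ χ) (u w : ℝ) :
    (1 / 2) * (u - prox q χ u) ^ 2 + χ * |prox q χ u| ^ q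
      ≤ (1 / 2) * (u - w) ^ 2 + χ * |w| ^ q := by
  have hcont : Continuous fun z : ℝ => (1 / 2) * (u - z) ^ 2 + χ * |z| ^ q :=
    (by fun_prop : Continuous fun z : ℝ => (1 / 2) * (u - z) ^ 2).add
      (continuous_const.mul (continuous_abs.rpow_const fun _ => Or.inr hq))
  have hsq : Tendsto (fun z : ℝ => (1 / 2) * dist u z ^ 2) (cocompact ℝ) atTop :=
    ((tendsto_pow_atTop two_ne_zero).comp
      (tendsto_dist_left_cocompact_atTop u)).const_mul_atTop (by norm_num)
  have hcoer : Tendsto (fun z : ℝ => (1 / 2) * (u - z) ^ 2 + χ * |z| ^ q)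
      (cocompact ℝ) atTop := by
    refine tendsto_atTop_mono (fun z => ?_) hsq
    rw [Real.dist_eq, sq_abs]
    exact le_add_of_nonneg_right (by positivity)
  exact Classical.epsilon_spec (hcont.exists_forall_le hcoer) w

theorem sq_sub_prox_le {q χ : ℝ} (hq : 0 < q) (hχ : 0 ≤ χ) (u : ℝ) :
    (u - prox q χ u) ^ 2 ≤ 2 * χ * |u| ^ q := by
  have h := prox_isMinimizer hq.le hχ u u
  have hnonneg : 0 ≤ χ * |prox q χ u| ^ q := by positivity
  rw [sub_self] at h
  linarith

theorem tendsto_prox_div_self {q χ : ℝ} (hq0 : 0 < q) (hq2 : q < 2) (hχ : 0 ≤ χ) :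
    Tendsto (fun u : ℝ => prox q χ u / u) atTop (nhds 1) := by
  have hpow : Tendsto (fun u : ℝ => 2 * χ * u ^ (-(2 - q))) atTop (nhds 0) := by
    simpa using (tendsto_rpow_neg_atTop (sub_pos.mpr hq2)).const_mul (2 * χ)
  have hsq : Tendsto (fun u : ℝ => (1 - prox q χ u / u) ^ 2) atTop (nhds 0) := by
    refine tendsto_of_tendsto_of_tendsto_of_le_of_le' tendsto_const_nhds hpow
      (Eventually.of_forall fun u => sq_nonneg _) ?_
    filter_upwards [eventually_gt_atTop 0] with u hu
    have h := sq_sub_prox_le hq0 hχ u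
    rw [abs_of_pos hu] at h
    rw [neg_sub, Real.rpow_sub hu, Real.rpow_two, one_sub_div hu.ne', div_pow, ← mul_div_assoc]
    gcongr
  have habs : Tendsto (fun u : ℝ => |1 - prox q χ u / u|) atTop (nhds 0) := by
    simpa [Real.sqrt_sq_eq_abs] using hsq.sqrt
  simpa using ((tendsto_zero_iff_abs_tendsto_zero _).mpr habs).const_sub 1

/-- For `1 < q < 2` and `χ > 0`, `|u| / |η_q(u; χ)| → 1` as `u → +∞`. -/
theorem stmt_6 (q χ : ℝ) (hq1 : 1 < q) (hq2 : q < 2) (hχ : 0 < χ) :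
    Tendsto (fun u : ℝ => |u| / |prox q χ u|) atTop (nhds 1) := by
  have h := ((tendsto_prox_div_self (zero_lt_one.trans hq1) hq2 hχ.le).inv₀ one_ne_zero).abs
  simpa [abs_div] using h
end

section
/- Let q > 1 and fix u ∈ ℝ. Then, as α → ∞, one has η_q(u; α) → 0 and α·|η_q(u; α)|^{q−1} → |u|/q. -/
open Filter

/-- The proximal objective attains its infimum, so `prox` is a global minimizer of it. -/
theorem prox_le {q χ : ℝ} (hq : 0 < q) (hχ : 0 ≤ χ) (u w : ℝ) :
    (1 / 2) * (u - prox q χ u) ^ 2 + χ * |prox q χ u| ^ q ≤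
      (1 / 2) * (u - w) ^ 2 + χ * |w| ^ q := by
  have hex : ∃ z : ℝ, ∀ w : ℝ,
      (1 / 2) * (u - z) ^ 2 + χ * |z| ^ q ≤ (1 / 2) * (u - w) ^ 2 + χ * |w| ^ q := by
    have hcont : Continuous fun z : ℝ => (1 / 2) * (u - z) ^ 2 + χ * |z| ^ q := by
      have : Continuous fun z : ℝ => |z| ^ q :=
        continuous_abs.rpow_const fun _ => Or.inr hq.le
      fun_prop
    have hzero : (0 : ℝ) ∈ Set.Icc (-(2 * |u|)) (2 * |u|) := by
      constructor <;> linarith [abs_nonneg u]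
    obtain ⟨z, -, hz⟩ := isCompact_Icc.exists_isMinOn ⟨0, hzero⟩ hcont.continuousOn
    refine ⟨z, fun w => ?_⟩
    by_cases hw : w ∈ Set.Icc (-(2 * |u|)) (2 * |u|)
    · exact hz hw
    · have h0 := hz hzero
      simp only [Set.mem_ofPred_eq, sub_zero, abs_zero, Real.zero_rpow hq.ne', mul_zero,
        add_zero] at h0
      have hw' : 2 * |u| < |w| := by
        rw [Set.mem_Icc, ← abs_le] at hw
        exact not_le.mp hw
      have hdist : |u| ≤ |u - w| := by
        have := abs_sub_abs_le_abs_sub w u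
        rw [abs_sub_comm] at this
        linarith
      have hsq : u ^ 2 ≤ (u - w) ^ 2 := sq_le_sq.mpr hdist
      have hpen : 0 ≤ χ * |w| ^ q := by positivity
      linarith
  exact Classical.epsilon_spec hex w

/-- The absolute value of the first-order optimality condition for `prox`. -/
theorem mul_abs_prox_rpow_sub_one {q χ : ℝ} (hq : 1 < q) (hχ : 0 ≤ χ) (u : ℝ) :
    χ * |prox q χ u| ^ (q - 1) = |u - prox q χ u| / q := by
  have hmin : IsLocalMin (fun z : ℝ => (1 / 2) * (u - z) ^ 2 + χ * |z| ^ q) (prox q χ u) :=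
    Eventually.of_forall (prox_le (by linarith) hχ u)
  generalize prox q χ u = z at hmin ⊢
  have hderiv := ((((hasDerivAt_id z).const_sub u).pow 2).const_mul (1 / 2)).add
    ((hasDerivAt_abs_rpow z hq).const_mul χ)
  have hcrit := hmin.hasDerivAt_eq_zero hderiv
  have hstat : u - z = χ * q * (|z| ^ (q - 2) * z) := by
    simp only [id] at hcrit
    norm_num at hcrit
    linarith
  have hpow : |z| ^ (q - 2) * |z| = |z| ^ (q - 1) := by
    rcases eq_or_ne z 0 with rfl | hz
    · simp [Real.zero_rpow (sub_ne_zero.mpr hq.ne')]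
    · rw [← Real.rpow_add_one (abs_ne_zero.mpr hz)]
      congr 1
      ring
  have hq0 : 0 < q := by linarith
  rw [hstat, abs_mul, abs_mul, abs_mul, abs_of_nonneg hχ, abs_of_pos hq0,
    abs_of_nonneg (Real.rpow_nonneg (abs_nonneg z) _), hpow]
  field_simp

theorem tendsto_prox_atTop {q : ℝ} (hq : 0 < q) (u : ℝ) :
    Tendsto (fun α : ℝ => prox q α u) atTop (nhds 0) := by
  have hbound : ∀ᶠ α : ℝ in atTop, |prox q α u| ≤ (u ^ 2 / 2 / α) ^ q⁻¹ := by
    filter_upwards [eventually_gt_atTop 0] with α hα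
    have h := prox_le hq hα.le u 0
    rw [abs_zero, Real.zero_rpow hq.ne'] at h
    rw [Real.le_rpow_inv_iff_of_pos (abs_nonneg _) (by positivity) hq, le_div_iff₀ hα]
    nlinarith [sq_nonneg (u - prox q α u)]
  have hlim : Tendsto (fun α : ℝ => (u ^ 2 / 2 / α) ^ q⁻¹) atTop (nhds 0) := by
    have h := (tendsto_const_nhds (x := u ^ 2 / 2)).div_atTop (tendsto_id (α := ℝ))
    simpa [Real.zero_rpow (inv_ne_zero hq.ne')] using
      h.rpow_const (p := q⁻¹) (Or.inr (inv_nonneg.mpr hq.le))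
  exact squeeze_zero_norm' hbound hlim

/-- For `q > 1` and fixed `u ∈ ℝ`: as `α → ∞`, `η_q(u; α) → 0` and
`α·|η_q(u; α)|^{q−1} → |u|/q`. -/
theorem stmt_7 (q u : ℝ) (hq : 1 < q) :
    Tendsto (fun α : ℝ => prox q α u) atTop (nhds 0) ∧
    Tendsto (fun α : ℝ => α * |prox q α u| ^ (q - 1)) atTop (nhds (|u| / q)) := by
  have hlim := tendsto_prox_atTop (zero_lt_one.trans hq) u
  refine ⟨hlim, ?_⟩
  have hres : Tendsto (fun α : ℝ => |u - prox q α u| / q) atTop (nhds (|u| / q)) := by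
    simpa using (hlim.const_sub u).abs.div_const q
  refine hres.congr' ?_
  filter_upwards [eventually_ge_atTop 0] with α hα
  exact (mul_abs_prox_rpow_sub_one hq hα u).symm
end

section
/- For q ∈ (1, ∞) define c_q = (E|Z|^{(2−q)/(q−1)})² / ((q−1)² · E|Z|^{2/(q−1)}). Then c_q ≤ 1 for every q > 1, and c_2 = 1; in particular the maximum of c_q over q ∈ (1, ∞) is achieved at q = 2. -/
open MeasureTheory ProbabilityTheory

/-- The constant `c_q = (E|Z|^{(2−q)/(q−1)})² / ((q−1)²·E|Z|^{2/(q−1)})`, `Z` standard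
Gaussian. -/
noncomputable def cConst (q : ℝ) : ℝ :=
  (∫ z, |z| ^ ((2 - q) / (q - 1)) ∂(gaussianReal 0 1)) ^ 2 /
    ((q - 1) ^ 2 * ∫ z, |z| ^ (2 / (q - 1)) ∂(gaussianReal 0 1))

/-- The absolute moments of the standard Gaussian, in terms of the Gamma function. -/
theorem integral_abs_rpow_gaussianReal {a : ℝ} (ha : -1 < a) :
    ∫ z, |z| ^ a ∂(gaussianReal 0 1) = 2 ^ (a / 2) * Real.Gamma ((a + 1) / 2) / √Real.pi := by
  rw [integral_gaussianReal_eq_integral_smul one_ne_zero]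
  have h1 : ∀ z : ℝ, gaussianPDFReal 0 1 z • |z| ^ a =
      (√(2 * Real.pi))⁻¹ * (fun x : ℝ => x ^ a * Real.exp (-(1 / 2) * x ^ (2 : ℝ))) |z| := by
    intro z
    simp only [gaussianPDFReal, smul_eq_mul, Real.rpow_two, sq_abs, NNReal.coe_one, mul_one,
      sub_zero]
    rw [show -z ^ 2 / 2 = -(1 / 2) * z ^ 2 by ring]
    ring
  simp_rw [h1]
  rw [integral_const_mul,
    integral_comp_abs (f := fun x : ℝ => x ^ a * Real.exp (-(1 / 2) * x ^ (2 : ℝ))),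
    integral_rpow_mul_exp_neg_mul_rpow two_pos ha one_half_pos]
  have h2 : (1 / 2 : ℝ) ^ (-(a + 1) / 2) = 2 ^ (a / 2) * √2 := by
    rw [one_div, Real.inv_rpow two_pos.le, ← Real.rpow_neg two_pos.le, Real.sqrt_eq_rpow,
      ← Real.rpow_add two_pos]
    ring_nf
  rw [h2, Real.sqrt_mul two_pos.le]
  have := Real.pi_pos
  field_simp

/-- Stein's identity for the function `z ↦ sign z * |z| ^ p`. -/
theorem mul_integral_abs_rpow_sub_one_gaussianReal {p : ℝ} (hp : 0 < p) :
    p * ∫ z, |z| ^ (p - 1) ∂(gaussianReal 0 1) = ∫ z, |z| ^ (p + 1) ∂(gaussianReal 0 1) := by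
  rw [integral_abs_rpow_gaussianReal (by linarith), integral_abs_rpow_gaussianReal (by linarith),
    show (p + 1 + 1) / 2 = p / 2 + 1 by ring, Real.Gamma_add_one (by positivity),
    show (p + 1) / 2 = (p - 1) / 2 + 1 by ring, Real.rpow_add_one two_ne_zero, sub_add_cancel]
  ring

theorem sq_Gamma_midpoint_le {s t : ℝ} (hs : 0 < s) (ht : 0 < t) :
    Real.Gamma ((s + t) / 2) ^ 2 ≤ Real.Gamma s * Real.Gamma t := by
  have h := Real.Gamma_mul_add_mul_le_rpow_Gamma_mul_rpow_Gamma hs ht one_half_pos one_half_pos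
    (by norm_num)
  have hs' := Real.Gamma_pos_of_pos hs
  have ht' := Real.Gamma_pos_of_pos ht
  rw [← Real.mul_rpow hs'.le ht'.le, ← Real.sqrt_eq_rpow,
    show 1 / 2 * s + 1 / 2 * t = (s + t) / 2 by ring] at h
  exact (Real.le_sqrt' (Real.Gamma_pos_of_pos (by positivity))).1 h

theorem sq_integral_abs_rpow_add_one_gaussianReal_le {p : ℝ} (hp : 0 < p) :
    (∫ z, |z| ^ (p + 1) ∂(gaussianReal 0 1)) ^ 2 ≤ ∫ z, |z| ^ (2 * p) ∂(gaussianReal 0 1) := by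
  rw [integral_abs_rpow_gaussianReal (by linarith), integral_abs_rpow_gaussianReal (by linarith)]
  have h := sq_Gamma_midpoint_le (show (0 : ℝ) < 1 / 2 + 1 by norm_num)
    (show 0 < (2 * p + 1) / 2 by positivity)
  rw [Real.Gamma_add_one (by norm_num), Real.Gamma_one_half_eq,
    show (1 / 2 + 1 + (2 * p + 1) / 2) / 2 = (p + 1 + 1) / 2 by ring] at h
  have h2 : ((2 : ℝ) ^ ((p + 1) / 2)) ^ 2 = 2 ^ (2 * p / 2) * 2 := by
    rw [← Real.rpow_mul_natCast two_pos.le, ← Real.rpow_add_one two_ne_zero]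
    push_cast
    ring_nf
  have hpi : 0 < √Real.pi := Real.sqrt_pos.2 Real.pi_pos
  rw [div_pow, mul_pow, h2, div_le_div_iff₀ (by positivity) hpi]
  calc _ ≤ 2 ^ (2 * p / 2) * 2 * (1 / 2 * √Real.pi * Real.Gamma ((2 * p + 1) / 2)) * √Real.pi := by
        gcongr
    _ = _ := by ring

theorem integral_abs_rpow_gaussianReal_pos {a : ℝ} (ha : -1 < a) :
    0 < ∫ z, |z| ^ a ∂(gaussianReal 0 1) := by
  rw [integral_abs_rpow_gaussianReal ha]
  have := Real.Gamma_pos_of_pos (show 0 < (a + 1) / 2 by linarith)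
  have := Real.pi_pos
  positivity

theorem cConst_eq {q : ℝ} (hq : 1 < q) :
    cConst q = (∫ z, |z| ^ ((q - 1)⁻¹ + 1) ∂(gaussianReal 0 1)) ^ 2 /
      ∫ z, |z| ^ (2 * (q - 1)⁻¹) ∂(gaussianReal 0 1) := by
  have hq' : 0 < q - 1 := sub_pos.2 hq
  rw [cConst, ← mul_integral_abs_rpow_sub_one_gaussianReal (inv_pos.2 hq'),
    show (2 - q) / (q - 1) = (q - 1)⁻¹ - 1 by field_simp; ring, div_eq_mul_inv 2,
    mul_pow, inv_pow]
  field_simp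

/-- `c_q ≤ 1` for every `q > 1` and `c_2 = 1`; in particular the
maximum of `c_q` over `q ∈ (1, ∞)` is achieved at `q = 2`. -/
theorem stmt_10 : (∀ q : ℝ, 1 < q → cConst q ≤ 1) ∧ cConst 2 = 1 := by
  refine ⟨fun q hq => ?_, ?_⟩
  · have hp : 0 < (q - 1)⁻¹ := inv_pos.2 (sub_pos.2 hq)
    rw [cConst_eq hq, div_le_one (integral_abs_rpow_gaussianReal_pos (by linarith))]
    exact sq_integral_abs_rpow_add_one_gaussianReal_le hp
  · have h := mul_integral_abs_rpow_sub_one_gaussianReal one_pos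
    norm_num at h
    rw [cConst_eq one_lt_two]
    norm_num [← h]
end

section
/- Let μ ≥ 0 and α ≥ 0. Then ∫_ℝ (η₁(μ + z; α) − μ)² φ(z) dz = (1 + α² − μ²)·(Φ(μ − α) + Φ(−μ − α)) − (α + μ)·φ(α − μ) − (α − μ)·φ(α + μ) + μ². -/
open MeasureTheory ProbabilityTheory

/-- The soft-thresholding operator `η₁(u; χ) = sgn(u)·max(|u| − χ, 0)`. -/
noncomputable def softThresh (u χ : ℝ) : ℝ :=
  Real.sign u * max (|u| - χ) 0

/-- The standard normal density `φ(s) = (2π)^{−1/2} e^{−s²/2}`. -/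
noncomputable def stdGaussPDF (s : ℝ) : ℝ :=
  (Real.sqrt (2 * Real.pi))⁻¹ * Real.exp (-s ^ 2 / 2)

/-- The standard normal cumulative distribution function `Φ`. -/
noncomputable def stdGaussCDF (x : ℝ) : ℝ :=
  ∫ t in Set.Iic x, stdGaussPDF t

theorem stdGaussPDF_eq_gaussianPDFReal : stdGaussPDF = gaussianPDFReal 0 1 := by
  ext s
  simp [stdGaussPDF, gaussianPDFReal]

theorem stdGaussPDF_neg (s : ℝ) : stdGaussPDF (-s) = stdGaussPDF s := by
  simp [stdGaussPDF]

theorem integrable_stdGaussPDF : Integrable stdGaussPDF := by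
  rw [stdGaussPDF_eq_gaussianPDFReal]
  exact integrable_gaussianPDFReal 0 1

theorem integral_stdGaussPDF : ∫ s, stdGaussPDF s = 1 := by
  rw [stdGaussPDF_eq_gaussianPDFReal]
  exact integral_gaussianPDFReal_eq_one 0 one_ne_zero

theorem integrable_pow_mul_stdGaussPDF (n : ℕ) :
    Integrable (fun s : ℝ => s ^ n * stdGaussPDF s) := by
  have h := integrable_rpow_mul_exp_neg_mul_sq (b := 1 / 2) (by norm_num)
    (s := (n : ℝ)) (by linarith [(n.cast_nonneg : (0 : ℝ) ≤ n)])
  convert h.const_mul (Real.sqrt (2 * Real.pi))⁻¹ using 1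
  ext s
  rw [Real.rpow_natCast, stdGaussPDF, show -s ^ 2 / 2 = -(1 / 2) * s ^ 2 by ring]
  ring

theorem integrable_quadratic_mul_stdGaussPDF (a b c : ℝ) :
    Integrable (fun s : ℝ => (a * s ^ 2 + b * s + c) * stdGaussPDF s) := by
  refine ((((integrable_pow_mul_stdGaussPDF 2).const_mul a).add
    ((integrable_pow_mul_stdGaussPDF 1).const_mul b)).add
    (integrable_stdGaussPDF.const_mul c)).congr (ae_of_all _ fun s => ?_)
  simp only [Pi.add_apply]
  ring

theorem hasDerivAt_stdGaussPDF (s : ℝ) : HasDerivAt stdGaussPDF (-s * stdGaussPDF s) s := by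
  have h : HasDerivAt (fun s : ℝ => -s ^ 2 / 2) (-s) s := by
    refine ((hasDerivAt_pow 2 s).neg.div_const 2).congr_deriv ?_
    norm_num
    ring
  refine (h.exp.const_mul (Real.sqrt (2 * Real.pi))⁻¹).congr_deriv ?_
  rw [stdGaussPDF]
  ring

/-- The truncated shifted second moment of the standard normal distribution. -/
theorem integral_Iic_shifted_sq_mul_stdGaussPDF (c d x : ℝ) :
    ∫ s in Set.Iic x, ((s + c) ^ 2 - d) * stdGaussPDF s =
      (1 + c ^ 2 - d) * stdGaussCDF x - (x + 2 * c) * stdGaussPDF x := by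
  have hderiv (s : ℝ) : HasDerivAt (fun s => -(s + 2 * c) * stdGaussPDF s)
      ((1 * s ^ 2 + 2 * c * s + -1) * stdGaussPDF s) s := by
    refine ((((hasDerivAt_id' s).add_const (2 * c)).fun_neg).mul
      (hasDerivAt_stdGaussPDF s)).congr_deriv ?_
    ring
  have hint := integrable_quadratic_mul_stdGaussPDF 1 (2 * c) (-1)
  have hint' : Integrable (fun s => -(s + 2 * c) * stdGaussPDF s) := by
    convert integrable_quadratic_mul_stdGaussPDF 0 (-1) (-(2 * c)) using 3
    ring
  have hlim := tendsto_zero_of_hasDerivAt_of_integrableOn_Iic (a := x)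
    (fun s _ => hderiv s) hint.integrableOn hint'.integrableOn
  have hFTC := integral_Iic_of_hasDerivAt_of_tendsto' (a := x)
    (fun s _ => hderiv s) hint.integrableOn hlim
  calc
    _ = ∫ s in Set.Iic x, (1 * s ^ 2 + 2 * c * s + -1) * stdGaussPDF s
          + (1 + c ^ 2 - d) * stdGaussPDF s := by
      congr 1
      ext s
      ring
    _ = _ := by
      rw [integral_add hint.integrableOn (integrable_stdGaussPDF.const_mul _).integrableOn,
        hFTC, integral_const_mul, stdGaussCDF]
      ring

theorem integral_Ioi_shifted_sq_mul_stdGaussPDF (c d x : ℝ) :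
    ∫ s in Set.Ioi x, ((s - c) ^ 2 - d) * stdGaussPDF s =
      (1 + c ^ 2 - d) * stdGaussCDF (-x) - (-x + 2 * c) * stdGaussPDF x := by
  rw [← stdGaussPDF_neg x, ← integral_Iic_shifted_sq_mul_stdGaussPDF,
    ← neg_neg x, ← integral_comp_neg_Iic, neg_neg]
  congr 1
  ext s
  rw [stdGaussPDF_neg]
  ring

theorem softThresh_sub_sq (μ α z : ℝ) (hα : 0 ≤ α) :
    (softThresh (μ + z) α - μ) ^ 2 =
      (Set.Iic (-μ - α)).indicator (fun s => (s + α) ^ 2 - μ ^ 2) z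
        + (Set.Ioi (α - μ)).indicator (fun s => (s - α) ^ 2 - μ ^ 2) z + μ ^ 2 := by
  unfold softThresh
  simp only [Set.indicator_apply, Set.mem_Iic, Set.mem_Ioi]
  rcases lt_trichotomy (μ + z) 0 with h | h | h
  · rw [Real.sign_of_neg h, abs_of_neg h, if_neg (by linarith : ¬ α - μ < z)]
    split_ifs with h1
    · rw [max_eq_left (by linarith)]
      ring
    · rw [max_eq_right (by linarith)]
      ring
  · rw [h, Real.sign_zero, if_neg (by linarith : ¬ α - μ < z)]
    split_ifs with h1
    · rw [show α = 0 by linarith, show z = -μ by linarith]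
      ring
    · ring
  · rw [Real.sign_of_pos h, abs_of_pos h, if_neg (by linarith : ¬ z ≤ -μ - α)]
    split_ifs with h1
    · rw [max_eq_left (by linarith)]
      ring
    · rw [max_eq_right (by linarith)]
      ring

/-- For `μ ≥ 0` and `α ≥ 0`,
`E(η₁(μ + Z; α) − μ)² = (1 + α² − μ²)(Φ(μ−α) + Φ(−μ−α)) − (α+μ)φ(α−μ) − (α−μ)φ(α+μ) + μ²`,
`Z` standard Gaussian. -/
theorem stmt_11 (μ α : ℝ) (hμ : 0 ≤ μ) (hα : 0 ≤ α) :
    ∫ z, (softThresh (μ + z) α - μ) ^ 2 ∂(gaussianReal 0 1) =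
      (1 + α ^ 2 - μ ^ 2) * (stdGaussCDF (μ - α) + stdGaussCDF (-μ - α))
        - (α + μ) * stdGaussPDF (α - μ) - (α - μ) * stdGaussPDF (α + μ) + μ ^ 2 := by
  have hint (c : ℝ) : Integrable (fun s : ℝ => ((s + c) ^ 2 - μ ^ 2) * stdGaussPDF s) := by
    convert integrable_quadratic_mul_stdGaussPDF 1 (2 * c) (c ^ 2 - μ ^ 2) using 3
    ring
  have hl := (hint α).indicator (measurableSet_Iic (a := -μ - α))
  have hr : Integrable ((Set.Ioi (α - μ)).indicator
      fun s : ℝ => ((s - α) ^ 2 - μ ^ 2) * stdGaussPDF s) :=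
    (hint (-α)).indicator measurableSet_Ioi
  rw [integral_gaussianReal_eq_integral_smul one_ne_zero, ← stdGaussPDF_eq_gaussianPDFReal]
  calc
    _ = ∫ z, (Set.Iic (-μ - α)).indicator
            (fun s : ℝ => ((s + α) ^ 2 - μ ^ 2) * stdGaussPDF s) z
          + (Set.Ioi (α - μ)).indicator
            (fun s : ℝ => ((s - α) ^ 2 - μ ^ 2) * stdGaussPDF s) z
          + μ ^ 2 * stdGaussPDF z := by
      congr 1
      ext z
      rw [softThresh_sub_sq μ α z hα, smul_eq_mul, Set.indicator_mul_left,
        Set.indicator_mul_left]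
      ring
    _ = _ := by
      rw [integral_add (hl.fun_add hr) (integrable_stdGaussPDF.const_mul _), integral_add hl hr,
        integral_indicator measurableSet_Iic, integral_indicator measurableSet_Ioi,
        integral_Iic_shifted_sq_mul_stdGaussPDF, integral_Ioi_shifted_sq_mul_stdGaussPDF,
        integral_const_mul, integral_stdGaussPDF, neg_sub,
        show -μ - α = -(α + μ) by ring, stdGaussPDF_neg]
      ring
end

section
/- Let G be a nonnegative, essentially bounded random variable with essential supremum M = esssup(G), and let f : ℝ → ℝ be a continuous nonnegative function with f(M) > 0. Then E[f(G)·e^{αG}] / (f(M)·E[e^{αG}]) → 1 as α → ∞. -/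
open MeasureTheory Filter

/-- A continuous function is integrable against a finite measure carried by a compact interval. -/
lemma Continuous.integrable_of_ae_mem_Icc {μ : Measure ℝ} [IsFiniteMeasure μ] {a b : ℝ}
    (hμ : ∀ᵐ x ∂μ, x ∈ Set.Icc a b) {g : ℝ → ℝ} (hg : Continuous g) : Integrable g μ := by
  rw [← Measure.restrict_eq_self_of_ae_mem hμ]
  exact hg.continuousOn.integrableOn_Icc

/-- As `α → ∞`, the means of a continuous function under the measures with density proportional
to `exp (α * x)` converge to its value at the right end point `b` of the support. -/
lemma tendsto_integral_mul_exp_div_integral_exp {μ : Measure ℝ} [IsFiniteMeasure μ] {a b : ℝ}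
    (hμ : ∀ᵐ x ∂μ, x ∈ Set.Icc a b) (hb : ∀ c < b, μ {x | c < x} ≠ 0)
    {f : ℝ → ℝ} (hf : Continuous f) :
    Tendsto (fun α : ℝ => (∫ x, f x * Real.exp (α * x) ∂μ) / ∫ x, Real.exp (α * x) ∂μ)
      atTop (nhds (f b)) := by
  have hcont : ∀ {g : ℝ → ℝ}, Continuous g → Integrable g μ :=
    fun hg => hg.integrable_of_ae_mem_Icc hμ
  obtain ⟨K, hK⟩ := isCompact_Icc.exists_bound_of_continuousOn
    (s := Set.Icc a b) (f := fun x => f x - f b) (by fun_prop)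
  rw [Metric.tendsto_nhds]
  intro ε hε
  obtain ⟨δ, hδ, hfδ⟩ := Metric.continuous_iff.1 hf b (ε / 2) (by positivity)
  set p : ℝ := μ.real {x | b - δ / 2 < x}
  have hp : 0 < p :=
    ENNReal.toReal_pos (hb _ (by linarith)) (measure_ne_top _ _)
  have hlower : ∀ α : ℝ, 0 ≤ α →
      p * Real.exp (α * (b - δ / 2)) ≤ ∫ x, Real.exp (α * x) ∂μ := by
    intro α hα
    have hs : MeasurableSet {x : ℝ | b - δ / 2 < x} := measurableSet_Ioi
    calc p * Real.exp (α * (b - δ / 2))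
        = ∫ _ in {x | b - δ / 2 < x}, Real.exp (α * (b - δ / 2)) ∂μ := by
          simp [p]
      _ ≤ ∫ x in {x | b - δ / 2 < x}, Real.exp (α * x) ∂μ :=
          setIntegral_mono_on (integrable_const _).integrableOn
            (hcont (by fun_prop)).integrableOn hs fun x (hx : _ < x) =>
              Real.exp_le_exp.2 (mul_le_mul_of_nonneg_left hx.le hα)
      _ ≤ ∫ x, Real.exp (α * x) ∂μ :=
          setIntegral_le_integral (hcont (by fun_prop)) (ae_of_all _ fun x => (Real.exp_pos _).le)
  have hupper : ∀ α : ℝ, 0 ≤ α →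
      |∫ x, (f x - f b) * Real.exp (α * x) ∂μ| ≤
        ε / 2 * ∫ x, Real.exp (α * x) ∂μ + μ.real Set.univ * (|K| * Real.exp (α * (b - δ))) := by
    intro α hα
    calc |∫ x, (f x - f b) * Real.exp (α * x) ∂μ|
        ≤ ∫ x, (ε / 2 * Real.exp (α * x) + |K| * Real.exp (α * (b - δ))) ∂μ := by
          rw [← Real.norm_eq_abs]
          refine norm_integral_le_of_norm_le (hcont ?_) ?_
          · fun_prop
          filter_upwards [hμ] with x hx
          rw [norm_mul, Real.norm_of_nonneg (Real.exp_pos _).le]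
          rcases lt_or_ge (b - δ) x with h | h
          · have hclose : ‖f x - f b‖ ≤ ε / 2 := by
              rw [← dist_eq_norm]
              refine (hfδ x ?_).le
              rw [Real.dist_eq, abs_lt]
              constructor <;> linarith [hx.2]
            exact (mul_le_mul_of_nonneg_right hclose (Real.exp_pos _).le).trans
              (le_add_of_nonneg_right (by positivity))
          · have hfar : ‖f x - f b‖ * Real.exp (α * x) ≤ |K| * Real.exp (α * (b - δ)) := by
              gcongr
              exact (hK x hx).trans (le_abs_self K)
            exact hfar.trans (le_add_of_nonneg_left (by positivity))
      _ = _ := by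
          rw [integral_add (hcont (by fun_prop)) (hcont (by fun_prop)), integral_const_mul,
            integral_const, smul_eq_mul]
  have hdecay : Tendsto (fun α : ℝ => μ.real Set.univ * |K| / p * Real.exp (-(α * (δ / 2))))
      atTop (nhds 0) := by
    have h : Tendsto (fun α : ℝ => Real.exp (-(α * (δ / 2)))) atTop (nhds 0) :=
      Real.tendsto_exp_neg_atTop_nhds_zero.comp (tendsto_id.atTop_mul_const (half_pos hδ))
    simpa using h.const_mul (μ.real Set.univ * |K| / p)
  filter_upwards [eventually_ge_atTop 0, hdecay.eventually_lt_const (half_pos hε)] with α hα hsmall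
  have hlow := hlower α hα
  have hI : 0 < ∫ x, Real.exp (α * x) ∂μ := lt_of_lt_of_le (by positivity) hlow
  have hsub : ∫ x, (f x - f b) * Real.exp (α * x) ∂μ =
      (∫ x, f x * Real.exp (α * x) ∂μ) - f b * ∫ x, Real.exp (α * x) ∂μ := by
    simp_rw [sub_mul]
    rw [integral_sub (hcont (by fun_prop)) (hcont (by fun_prop)), integral_const_mul]
  have htail : μ.real Set.univ * (|K| * Real.exp (α * (b - δ))) <
      ε / 2 * ∫ x, Real.exp (α * x) ∂μ := by
    calc μ.real Set.univ * (|K| * Real.exp (α * (b - δ)))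
        = μ.real Set.univ * |K| / p * Real.exp (-(α * (δ / 2))) *
            (p * Real.exp (α * (b - δ / 2))) := by
          rw [show α * (b - δ) = -(α * (δ / 2)) + α * (b - δ / 2) by ring, Real.exp_add]
          field_simp
      _ < ε / 2 * (p * Real.exp (α * (b - δ / 2))) := by gcongr
      _ ≤ _ := by gcongr
  rw [Real.dist_eq, div_sub' hI.ne', abs_div, abs_of_pos hI, div_lt_iff₀ hI, mul_comm _ (f b),
    ← hsub]
  linarith [hupper α hα]

/-- **Laplace approximation.** Let `G` be a nonnegative, essentially
bounded random variable with law `μ` and essential supremum `M` (i.e. `G ≤ M` a.s. and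
no smaller bound holds a.s.), and let `f` be a continuous nonnegative function with
`f(M) > 0`. Then `E[f(G)·e^{αG}] / (f(M)·E[e^{αG}]) → 1` as `α → ∞`. -/
theorem stmt_13 (μ : Measure ℝ) [IsProbabilityMeasure μ]
    (hnn : ∀ᵐ x ∂μ, 0 ≤ x)
    (M : ℝ) (hub : ∀ᵐ x ∂μ, x ≤ M)
    (hmin : ∀ M' : ℝ, M' < M → μ {x | M' < x} ≠ 0)
    (f : ℝ → ℝ) (hf : Continuous f) (hfnn : ∀ x, 0 ≤ f x) (hfM : 0 < f M) :
    Tendsto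
      (fun α : ℝ =>
        (∫ x, f x * Real.exp (α * x) ∂μ) / (f M * ∫ x, Real.exp (α * x) ∂μ))
      atTop (nhds 1) := by
  have h := (tendsto_integral_mul_exp_div_integral_exp (hnn.and hub) hmin hf).div_const (f M)
  rw [div_self hfM.ne'] at h
  simpa only [div_div, mul_comm (f M)] using h
end

section
/- Let X be a nonnegative random variable with law μ satisfying P(X > 0) = 1, and let ξ > ζ > 0 be such that P(X ≤ ζ) ≤ 1/4 and P(ζ < X ≤ ξ) ≥ 1/4. Let a, c : (0, ∞) → (0, ∞) be functions with a(s) → ∞ and c(s) → ∞ as s → ∞. Then there exists s₀ > 0 (depending only on a, c, ξ, ζ and the law of X) such that for every s > s₀ and every positive function b : (0, ∞) → (0, ∞), ∫_{[0, a(s)]} e^{b(s)·x − x²/c(s)} dμ(x) ≤ 3 · ∫_{(ζ, a(s)]} e^{b(s)·x − x²/c(s)} dμ(x). -/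
open MeasureTheory Filter

/-- Let `X ≥ 0` have law `μ` with `P(X > 0) = 1`, and let
`ξ > ζ > 0` satisfy `P(X ≤ ζ) ≤ 1/4` and `P(ζ < X ≤ ξ) ≥ 1/4`. Let `a, c` be positive
functions on `(0,∞)` tending to `∞` at `∞`. Then there is `s₀ > 0` such that for every
`s > s₀` and every positive function `b` on `(0,∞)`,
`∫_{[0,a(s)]} e^{b(s)x − x²/c(s)} dμ ≤ 3 ∫_{(ζ,a(s)]} e^{b(s)x − x²/c(s)} dμ`. -/
theorem stmt_14 (μ : Measure ℝ) [IsProbabilityMeasure μ]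
    (hpos : μ (Set.Ioi (0 : ℝ)) = 1)
    (ζ ξ : ℝ) (hζ : 0 < ζ) (hζξ : ζ < ξ)
    (h1 : μ (Set.Iic ζ) ≤ 1 / 4) (h2 : 1 / 4 ≤ μ (Set.Ioc ζ ξ))
    (a c : ℝ → ℝ)
    (haPos : ∀ s : ℝ, 0 < s → 0 < a s) (hcPos : ∀ s : ℝ, 0 < s → 0 < c s)
    (haTop : Tendsto a atTop atTop) (hcTop : Tendsto c atTop atTop) :
    ∃ s₀ : ℝ, 0 < s₀ ∧ ∀ s : ℝ, s₀ < s → ∀ b : ℝ → ℝ, (∀ t : ℝ, 0 < t → 0 < b t) →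
      (∫ x in Set.Icc 0 (a s), Real.exp (b s * x - x ^ 2 / c s) ∂μ) ≤
        3 * ∫ x in Set.Ioc ζ (a s), Real.exp (b s * x - x ^ 2 / c s) ∂μ := by
  obtain ⟨s₁, hs₁⟩ := eventually_atTop.1
    ((haTop.eventually_ge_atTop ξ).and (hcTop.eventually_ge_atTop (2 * ξ ^ 2)))
  refine ⟨max s₁ 1, by positivity, fun s hs b hb ↦ ?_⟩
  have hs0 : 0 < s := zero_lt_one.trans ((le_max_right _ _).trans_lt hs)
  obtain ⟨ha, hc⟩ := hs₁ s ((le_max_left _ _).trans hs.le)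
  have hbs := hb s hs0
  have hcs := hcPos s hs0
  set f : ℝ → ℝ := fun x ↦ Real.exp (b s * x - x ^ 2 / c s)
  have hf0 : ∀ x, 0 ≤ f x := fun x ↦ (Real.exp_pos _).le
  have hInt : IntegrableOn f (Set.Icc 0 (a s)) μ :=
    (by fun_prop : Continuous f).continuousOn.integrableOn_compact isCompact_Icc
  have hIntLow : IntegrableOn f (Set.Icc 0 ζ) μ :=
    hInt.mono_set (Set.Icc_subset_Icc_right (by linarith))
  have hIntHigh : IntegrableOn f (Set.Ioc ζ (a s)) μ :=
    hInt.mono_set fun x hx ↦ ⟨hζ.le.trans hx.1.le, hx.2⟩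
  have hIntMid : IntegrableOn f (Set.Ioc ζ ξ) μ :=
    hIntHigh.mono_set (Set.Ioc_subset_Ioc_right ha)
  have hsplit : ∫ x in Set.Icc 0 (a s), f x ∂μ =
      ∫ x in Set.Icc 0 ζ, f x ∂μ + ∫ x in Set.Ioc ζ (a s), f x ∂μ := by
    rw [← Set.Icc_union_Ioc_eq_Icc hζ.le (hζξ.le.trans ha)]
    exact setIntegral_union (Set.disjoint_left.2 fun x hx hx' ↦ hx'.1.not_ge hx.2)
      measurableSet_Ioc hIntLow hIntHigh
  have hmid : ∫ x in Set.Ioc ζ ξ, f x ∂μ ≤ ∫ x in Set.Ioc ζ (a s), f x ∂μ :=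
    setIntegral_mono_set hIntHigh (ae_of_all _ hf0)
      (Set.Ioc_subset_Ioc_right ha).eventuallyLE
  have hμlow : μ.real (Set.Icc 0 ζ) ≤ 1 / 4 := by
    have := ENNReal.toReal_mono (by simp) ((measure_mono (Set.Icc_subset_Iic_self (a := 0))).trans h1)
    simpa [Measure.real] using this
  have hμmid : 1 / 4 ≤ μ.real (Set.Ioc ζ ξ) := by
    have := ENNReal.toReal_mono (measure_ne_top μ _) h2
    simpa [Measure.real] using this
  have hE := Real.exp_pos (b s * ζ)
  have hlow : ∫ x in Set.Icc 0 ζ, f x ∂μ ≤ μ.real (Set.Icc 0 ζ) * Real.exp (b s * ζ) := by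
    rw [← smul_eq_mul, ← setIntegral_const]
    refine setIntegral_mono_on hIntLow (integrableOn_const (measure_ne_top μ _))
      measurableSet_Icc fun x hx ↦ Real.exp_le_exp.2 ?_
    have : 0 ≤ x ^ 2 / c s := by positivity
    nlinarith [hx.2]
  have hhalf : (1 / 2 : ℝ) ≤ Real.exp (-(1 / 2)) := by
    linarith [Real.add_one_le_exp (-(1 / 2 : ℝ))]
  have hlower : μ.real (Set.Ioc ζ ξ) * (Real.exp (b s * ζ) / 2) ≤
      ∫ x in Set.Ioc ζ ξ, f x ∂μ := by
    rw [← smul_eq_mul, ← setIntegral_const]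
    refine setIntegral_mono_on (integrableOn_const (measure_ne_top μ _)) hIntMid
      measurableSet_Ioc fun x hx ↦ ?_
    have hx2 : x ^ 2 / c s ≤ 1 / 2 := by
      rw [div_le_iff₀ hcs]
      nlinarith [hx.1, hx.2]
    calc Real.exp (b s * ζ) / 2 ≤ Real.exp (b s * ζ) * Real.exp (-(1 / 2)) := by nlinarith
      _ = Real.exp (b s * ζ + -(1 / 2)) := (Real.exp_add _ _).symm
      _ ≤ f x := Real.exp_le_exp.2 (by nlinarith [hx.1])
  have hcmp : μ.real (Set.Icc 0 ζ) * Real.exp (b s * ζ) ≤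
      2 * (μ.real (Set.Ioc ζ ξ) * (Real.exp (b s * ζ) / 2)) := by
    nlinarith
  rw [hsplit]
  linarith
end

section
/- Let G be a real random variable with G > 0 almost surely, and let Z be a standard Gaussian random variable independent of G. Let 0 < τ₁ < τ₂ and t₁, t₂ > 0. If P(|G + τ₁·Z| > τ₁·t₁) = P(|G + τ₂·Z| > τ₂·t₂), then t₁ > t₂; consequently P(|Z| > t₁) < P(|Z| > t₂). -/
open MeasureTheory ProbabilityTheory

lemma continuous_gaussianPDFReal_standard : Continuous (gaussianPDFReal 0 1) := by
  unfold gaussianPDFReal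
  fun_prop

lemma gaussianPDFReal_standard_lt {x y : ℝ} (h : |x| < |y|) :
    gaussianPDFReal 0 1 y < gaussianPDFReal 0 1 x := by
  have hsq : x ^ 2 < y ^ 2 := sq_lt_sq.mpr h
  unfold gaussianPDFReal
  apply mul_lt_mul_of_pos_left
  · rw [Real.exp_lt_exp]
    simp only [sub_zero, NNReal.coe_one, mul_one]
    linarith
  · simp only [NNReal.coe_one]
    positivity

/-- The standard Gaussian mass of a window of fixed width decreases as it moves away from zero. -/
lemma gaussianPDFReal_standard_window_lt {a b t : ℝ} (ha : 0 ≤ a) (hab : a < b) (ht : 0 < t) :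
    ∫ x in (-t - b)..(t - b), gaussianPDFReal 0 1 x
      < ∫ x in (-t - a)..(t - a), gaussianPDFReal 0 1 x := by
  have hc := continuous_gaussianPDFReal_standard
  have hi : ∀ u v : ℝ, IntervalIntegrable (gaussianPDFReal 0 1) volume u v :=
    fun u v ↦ hc.intervalIntegrable u v
  have hpos : 0 < ∫ x in a..b, (gaussianPDFReal 0 1 (t - x) - gaussianPDFReal 0 1 (-t - x)) := by
    apply intervalIntegral.intervalIntegral_pos_of_pos_on _ _ hab
    · exact (by fun_prop : Continuous _).intervalIntegrable _ _
    · intro x hx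
      refine sub_pos.mpr (gaussianPDFReal_standard_lt (sq_lt_sq.mp ?_))
      nlinarith [mul_pos ht (ha.trans_lt hx.1)]
  rw [intervalIntegral.integral_sub ((by fun_prop : Continuous _).intervalIntegrable _ _)
    ((by fun_prop : Continuous _).intervalIntegrable _ _),
    intervalIntegral.integral_comp_sub_left (gaussianPDFReal 0 1),
    intervalIntegral.integral_comp_sub_left (gaussianPDFReal 0 1)] at hpos
  have h₁ := intervalIntegral.integral_add_adjacent_intervals (hi (-t - b) (t - b)) (hi _ (t - a))
  have h₂ := intervalIntegral.integral_add_adjacent_intervals (hi (-t - b) (-t - a)) (hi _ (t - a))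
  linarith

lemma gaussianReal_standard_tail_eq (a : ℝ) {t : ℝ} (ht : 0 < t) :
    (gaussianReal 0 1) {z : ℝ | t < |a + z|}
      = ENNReal.ofReal (1 - ∫ x in (-t - a)..(t - a), gaussianPDFReal 0 1 x) := by
  have hset : {z : ℝ | t < |a + z|} = (Set.Icc (-t - a) (t - a))ᶜ := by
    ext z
    rw [Set.mem_compl_iff, Set.mem_ofPred_eq, ← not_le, abs_le, Set.mem_Icc]
    refine not_congr (and_congr ?_ ?_) <;> constructor <;> intro h <;> linarith
  rw [hset, prob_compl_eq_one_sub measurableSet_Icc,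
    gaussianReal_apply_eq_integral 0 one_ne_zero, integral_Icc_eq_integral_Ioc,
    ← intervalIntegral.integral_of_le (by linarith), ENNReal.ofReal_sub, ENNReal.ofReal_one]
  exact intervalIntegral.integral_nonneg (by linarith) fun x _ ↦ gaussianPDFReal_nonneg 0 1 x

lemma intervalIntegral_gaussianPDFReal_standard_le_one {u v : ℝ} (h : u ≤ v) :
    ∫ x in u..v, gaussianPDFReal 0 1 x ≤ 1 := by
  rw [intervalIntegral.integral_of_le h, ← ENNReal.ofReal_le_one,
    ← gaussianReal_apply_eq_integral 0 one_ne_zero]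
  exact prob_le_one

lemma gaussianReal_standard_tail_lt {a b t : ℝ} (ha : 0 ≤ a) (hab : a < b) (ht : 0 < t) :
    (gaussianReal 0 1) {z : ℝ | t < |a + z|} < (gaussianReal 0 1) {z : ℝ | t < |b + z|} := by
  have hw := gaussianPDFReal_standard_window_lt ha hab ht
  have h_one := intervalIntegral_gaussianPDFReal_standard_le_one
    (show -t - a ≤ t - a by linarith)
  rw [gaussianReal_standard_tail_eq a ht, gaussianReal_standard_tail_eq b ht,
    ENNReal.ofReal_lt_ofReal_iff (by linarith)]
  linarith

lemma gaussianReal_standard_abs_tail_lt {s t : ℝ} (hs : 0 < s) (hst : s < t) :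
    (gaussianReal 0 1) {z : ℝ | t < |z|} < (gaussianReal 0 1) {z : ℝ | s < |z|} := by
  have hpos : (gaussianReal 0 1) (Set.Ioo s t) ≠ 0 := fun h ↦ by
    have := gaussianReal_absolutelyContinuous' 0 one_ne_zero h
    rw [Real.volume_Ioo, ENNReal.ofReal_eq_zero] at this
    linarith
  have hdisj : Disjoint {z : ℝ | t < |z|} (Set.Ioo s t) := by
    refine Set.disjoint_left.mpr fun z (hz : t < |z|) hz' ↦ ?_
    rw [abs_of_pos (hs.trans hz'.1)] at hz
    exact hz.not_gt hz'.2
  calc (gaussianReal 0 1) {z : ℝ | t < |z|}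
      < (gaussianReal 0 1) {z : ℝ | t < |z|} + (gaussianReal 0 1) (Set.Ioo s t) :=
        ENNReal.lt_add_right (measure_ne_top _ _) hpos
    _ = (gaussianReal 0 1) ({z : ℝ | t < |z|} ∪ Set.Ioo s t) :=
        (measure_union hdisj measurableSet_Ioo).symm
    _ ≤ (gaussianReal 0 1) {z : ℝ | s < |z|} := by
        refine measure_mono (Set.union_subset (fun z (hz : t < |z|) ↦ hst.trans hz) ?_)
        exact fun z hz ↦ hz.1.trans_le (le_abs_self z)

/-- Let `G > 0` a.s. have law `ν` and let `Z` be standard Gaussian,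
independent of `G` (so the pair has law `ν × N(0,1)`). Let `0 < τ₁ < τ₂` and
`t₁, t₂ > 0`. If `P(|G + τ₁Z| > τ₁t₁) = P(|G + τ₂Z| > τ₂t₂)`, then `t₁ > t₂`, and
consequently `P(|Z| > t₁) < P(|Z| > t₂)`. -/
theorem stmt_16 (ν : Measure ℝ) [IsProbabilityMeasure ν]
    (hpos : ν (Set.Ioi (0 : ℝ)) = 1)
    (τ₁ τ₂ t₁ t₂ : ℝ) (hτ₁ : 0 < τ₁) (hττ : τ₁ < τ₂) (ht₁ : 0 < t₁) (ht₂ : 0 < t₂)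
    (heq : (ν.prod (gaussianReal 0 1)) {p : ℝ × ℝ | τ₁ * t₁ < |p.1 + τ₁ * p.2|} =
           (ν.prod (gaussianReal 0 1)) {p : ℝ × ℝ | τ₂ * t₂ < |p.1 + τ₂ * p.2|}) :
    t₂ < t₁ ∧
      (gaussianReal 0 1) {z : ℝ | t₁ < |z|} < (gaussianReal 0 1) {z : ℝ | t₂ < |z|} := by
  have hslice : ∀ {τ : ℝ}, 0 < τ → ∀ t g : ℝ,
      Prod.mk g ⁻¹' {p : ℝ × ℝ | τ * t < |p.1 + τ * p.2|} = {z : ℝ | t < |g / τ + z|} := by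
    intro τ hτ t g
    ext z
    have : g + τ * z = τ * (g / τ + z) := by field_simp
    simp only [Set.mem_preimage, Set.mem_ofPred_eq]
    rw [this, abs_mul, abs_of_pos hτ, mul_lt_mul_iff_right₀ hτ]
  have hmeas : ∀ τ t : ℝ, MeasurableSet {p : ℝ × ℝ | τ * t < |p.1 + τ * p.2|} := fun τ t ↦
    measurableSet_lt (by fun_prop) (by fun_prop)
  have hτ₂ : 0 < τ₂ := hτ₁.trans hττ
  have hlt : t₂ < t₁ := by
    by_contra! hle
    refine heq.not_gt ?_
    rw [Measure.prod_apply (hmeas τ₁ t₁), Measure.prod_apply (hmeas τ₂ t₂)]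
    refine lintegral_strict_mono (IsProbabilityMeasure.ne_zero ν)
      (measurable_measure_prodMk_left (hmeas τ₁ t₁)).aemeasurable ?_ ?_
    · rw [← Measure.prod_apply (hmeas τ₂ t₂)]
      exact measure_ne_top _ _
    · have hae : ∀ᵐ g ∂ν, g ∈ Set.Ioi (0 : ℝ) := (prob_compl_eq_zero_iff measurableSet_Ioi).mpr hpos
      filter_upwards [hae] with g hg
      rw [hslice hτ₁, hslice hτ₂]
      calc (gaussianReal 0 1) {z : ℝ | t₂ < |g / τ₂ + z|}
          ≤ (gaussianReal 0 1) {z : ℝ | t₁ < |g / τ₂ + z|} :=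
            measure_mono fun z (hz : t₂ < _) ↦ hle.trans_lt hz
        _ < (gaussianReal 0 1) {z : ℝ | t₁ < |g / τ₁ + z|} :=
            gaussianReal_standard_tail_lt (div_pos hg hτ₂).le
              (div_lt_div_of_pos_left hg hτ₁ hττ) ht₁
  exact ⟨hlt, gaussianReal_standard_abs_tail_lt ht₂ hlt⟩
end

section
/- Fix 1 < q ≤ 2, δ > 0 and ε ∈ (0, 1). Let p_G be a probability measure on ℝ with p_G({0}) = 0, let G have law p_G with E|G|^k < ∞ for every integer k ≥ 1, let B be a random variable with law p_B = (1 − ε)δ₀ + ε·p_G (δ₀ the point mass at 0), and let Z be a standard Gaussian random variable independent of B. Suppose that for each σ > 0 there are given τ(σ) > 0 and α(σ) > 0 such that τ(σ)² = σ² + (1/δ)·E(η_q(B + τ(σ)·Z; α(σ)·τ(σ)^{2−q}) − B)² and α(σ) minimizes α ↦ E(η_q(B + τ(σ)·Z; α·τ(σ)^{2−q}) − B)² over α > 0. Let AMSE(σ) := E(η_q(B + τ(σ)·Z; α(σ)·τ(σ)^{2−q}) − B)². Then σ²·(AMSE(σ) − ε·E G²) → −ε²·(E G²)²·c_q as σ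 → ∞, where c_q = (E|Z|^{(2−q)/(q−1)})² / ((q−1)²·E|Z|^{2/(q−1)}). -/
open MeasureTheory ProbabilityTheory Filter

/-- The law `p_B = (1 − ε)·δ₀ + ε·p_G` of the signal coordinates. -/
noncomputable def mixLaw (ε : ℝ) (pG : Measure ℝ) : Measure ℝ :=
  (ENNReal.ofReal (1 - ε)) • Measure.dirac (0 : ℝ) + (ENNReal.ofReal ε) • pG

/-- The mean square error `E(η_q(B + τZ; α·τ^{2−q}) − B)²`, with `B ∼ p_B` and `Z`
standard Gaussian independent of `B`. -/
noncomputable def mse (q : ℝ) (pB : Measure ℝ) (α τ : ℝ) : ℝ :=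
  ∫ b, ∫ z, (prox q (α * τ ^ (2 - q)) (b + τ * z) - b) ^ 2 ∂(gaussianReal 0 1) ∂pB

/-- The signed power `t ↦ sgn(t)|t|^r`. -/
noncomputable def signedPow (r t : ℝ) : ℝ := t * |t| ^ (r - 1)

/-- The resolvent `(id + β · signedPow r)⁻¹`. -/
noncomputable def signedPowResolvent (r β u : ℝ) : ℝ :=
  Classical.epsilon fun w : ℝ => w + β * signedPow r w = u

lemma continuous_abs_rpow_sub_one {r : ℝ} (hr : 1 ≤ r) :
    Continuous fun t : ℝ => |t| ^ (r - 1) :=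
  continuous_abs.rpow_const fun _ => Or.inr (by linarith)

lemma continuous_signedPow {r : ℝ} (hr : 1 ≤ r) : Continuous (signedPow r) :=
  continuous_id.mul (continuous_abs_rpow_sub_one hr)

lemma abs_signedPow {r : ℝ} (hr : 1 ≤ r) (t : ℝ) : |signedPow r t| = |t| ^ r := by
  rw [signedPow, abs_mul, abs_of_nonneg (Real.rpow_nonneg (abs_nonneg t) _)]
  rcases eq_or_ne t 0 with rfl | ht
  · simp [Real.zero_rpow (by linarith : r ≠ 0)]
  · rw [← Real.rpow_one_add' (abs_nonneg t) (by linarith)]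
    congr 1; ring

lemma signedPow_neg (r t : ℝ) : signedPow r (-t) = -signedPow r t := by
  simp [signedPow]

lemma hasDerivAt_signedPow {r : ℝ} (hr : 1 ≤ r) (t : ℝ) :
    HasDerivAt (signedPow r) (r * |t| ^ (r - 1)) t := by
  have key : ∀ t : ℝ, t ≠ 0 → HasDerivAt (signedPow r) (r * |t| ^ (r - 1)) t := by
    intro t ht
    have h1 : HasDerivAt (fun x : ℝ => |x| ^ (r - 1))
        (SignType.sign t * (r - 1) * |t| ^ (r - 1 - 1)) t :=
      (hasDerivAt_abs ht).rpow_const (Or.inl (abs_ne_zero.2 ht))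
    have h2 := (hasDerivAt_id t).mul h1
    refine h2.congr_deriv (Eq.symm ?_)
    have : t * (SignType.sign t : ℝ) = |t| := by rw [mul_comm]; exact sign_mul_self t
    have h3 : |t| ^ (r - 1) = |t| * |t| ^ (r - 1 - 1) := by
      rw [Real.rpow_sub_one (abs_ne_zero.2 ht) (r - 1)]
      field_simp
    calc r * |t| ^ (r - 1) = 1 * |t| ^ (r - 1) + (r - 1) * |t| ^ (r - 1) := by ring
      _ = 1 * |t| ^ (r - 1) + (r - 1) * (t * (SignType.sign t : ℝ) * |t| ^ (r - 1 - 1)) := by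
          rw [this, ← h3]
      _ = _ := by simp only [id]; ring
  rcases eq_or_ne t 0 with rfl | ht
  · exact hasDerivAt_of_hasDerivAt_of_ne key (continuous_signedPow hr).continuousAt
      ((continuous_abs_rpow_sub_one hr).const_mul r).continuousAt
  · exact key t ht

lemma exists_signedPow_sub_eq {r : ℝ} (hr : 1 ≤ r) (x y : ℝ) :
    ∃ ξ ∈ Set.uIcc x y, signedPow r x - signedPow r y = r * |ξ| ^ (r - 1) * (x - y) := by
  rcases lt_trichotomy x y with h | rfl | h
  · obtain ⟨ξ, hξ, h'⟩ := exists_hasDerivAt_eq_slope (signedPow r) _ h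
      (continuous_signedPow hr).continuousOn fun t _ => hasDerivAt_signedPow hr t
    refine ⟨ξ, Set.Icc_subset_uIcc (Set.Ioo_subset_Icc_self hξ), ?_⟩
    rw [h']; field_simp [sub_ne_zero.2 h.ne']; ring
  · exact ⟨x, by simp, by simp⟩
  · obtain ⟨ξ, hξ, h'⟩ := exists_hasDerivAt_eq_slope (signedPow r) _ h
      (continuous_signedPow hr).continuousOn fun t _ => hasDerivAt_signedPow hr t
    refine ⟨ξ, Set.Icc_subset_uIcc' (Set.Ioo_subset_Icc_self hξ), ?_⟩
    rw [h']; field_simp [sub_ne_zero.2 h.ne']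

lemma monotone_signedPow {r : ℝ} (hr : 1 ≤ r) : Monotone (signedPow r) := by
  intro x y hxy
  obtain ⟨ξ, -, h⟩ := exists_signedPow_sub_eq hr y x
  have : 0 ≤ r * |ξ| ^ (r - 1) * (y - x) :=
    mul_nonneg (by positivity) (by linarith)
  linarith

section Resolvent

variable {r β : ℝ}

lemma signedPowResolvent_spec (hr : 1 ≤ r) (hβ : 0 ≤ β) (u : ℝ) :
    signedPowResolvent r β u + β * signedPow r (signedPowResolvent r β u) = u := by
  have hc : Continuous fun w => w + β * signedPow r w :=
    continuous_id.add (continuous_const.mul (continuous_signedPow hr))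
  have hs : ∀ t : ℝ, 0 ≤ t → 0 ≤ signedPow r t := fun t ht =>
    mul_nonneg ht (by positivity)
  have hex : u ∈ Set.Icc (-|u| + β * signedPow r (-|u|)) (|u| + β * signedPow r |u|) := by
    have := mul_nonneg hβ (hs _ (abs_nonneg u))
    rw [signedPow_neg]
    constructor <;> linarith [neg_abs_le u, le_abs_self u]
  obtain ⟨w, -, hw⟩ := intermediate_value_Icc (by linarith [abs_nonneg u]) hc.continuousOn hex
  exact Classical.epsilon_spec (p := fun w : ℝ => w + β * signedPow r w = u) ⟨w, hw⟩

lemma signedPowResolvent_eq (hr : 1 ≤ r) (hβ : 0 ≤ β) {u w : ℝ}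
    (hw : w + β * signedPow r w = u) : signedPowResolvent r β u = w := by
  have hs := signedPowResolvent_spec hr hβ u
  have hm : StrictMono fun w => w + β * signedPow r w :=
    strictMono_id.add_monotone ((monotone_signedPow hr).const_mul hβ)
  exact hm.injective (hs.trans hw.symm)

lemma signedPowResolvent_neg (hr : 1 ≤ r) (hβ : 0 ≤ β) (u : ℝ) :
    signedPowResolvent r β (-u) = -signedPowResolvent r β u := by
  refine signedPowResolvent_eq hr hβ ?_
  rw [signedPow_neg]
  linarith [signedPowResolvent_spec hr hβ u]

lemma abs_signedPowResolvent_sub_le (hr : 1 ≤ r) (hβ : 0 ≤ β) (u v : ℝ) :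
    |signedPowResolvent r β u - signedPowResolvent r β v| ≤ |u - v| := by
  obtain ⟨ξ, -, h⟩ := exists_signedPow_sub_eq hr (signedPowResolvent r β u)
    (signedPowResolvent r β v)
  have hu := signedPowResolvent_spec hr hβ u
  have hv := signedPowResolvent_spec hr hβ v
  set x := signedPowResolvent r β u
  set y := signedPowResolvent r β v
  have hd : 0 ≤ β * (r * |ξ| ^ (r - 1)) := by positivity
  have e : u - v = (1 + β * (r * |ξ| ^ (r - 1))) * (x - y) := by
    rw [← hu, ← hv]; linear_combination β * h
  rw [e, abs_mul]
  rw [abs_of_nonneg (by linarith : 0 ≤ 1 + β * (r * |ξ| ^ (r - 1)))]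
  nlinarith [abs_nonneg (x - y)]

lemma continuous_signedPowResolvent (hr : 1 ≤ r) (hβ : 0 ≤ β) :
    Continuous (signedPowResolvent r β) :=
  (LipschitzWith.of_dist_le_mul (K := 1) fun u v => by
    simpa [Real.dist_eq] using abs_signedPowResolvent_sub_le hr hβ u v).continuous

lemma abs_signedPowResolvent_le (hr : 1 ≤ r) (hβ : 0 ≤ β) (u : ℝ) :
    |signedPowResolvent r β u| ≤ |u| := by
  have h0 : signedPowResolvent r β 0 = 0 := signedPowResolvent_eq hr hβ (by simp [signedPow])
  simpa [h0] using abs_signedPowResolvent_sub_le hr hβ u 0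

lemma abs_signedPow_resolvent_le (hr : 1 ≤ r) (hβ : 0 ≤ β) (u : ℝ) :
    |signedPow r (signedPowResolvent r β u)| ≤ |u| ^ r := by
  rw [abs_signedPow hr]
  exact Real.rpow_le_rpow (abs_nonneg _) (abs_signedPowResolvent_le hr hβ u) (by linarith)

lemma abs_signedPowResolvent_sub_self_le (hr : 1 ≤ r) (hβ : 0 ≤ β) (u : ℝ) :
    |signedPowResolvent r β u - u| ≤ β * |u| ^ r := by
  have h := signedPowResolvent_spec hr hβ u
  have : signedPowResolvent r β u - u = -(β * signedPow r (signedPowResolvent r β u)) := by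
    linarith
  rw [this, abs_neg, abs_mul, abs_of_nonneg hβ]
  exact mul_le_mul_of_nonneg_left (abs_signedPow_resolvent_le hr hβ u) hβ

/-- Mean value theorem for `signedPow r ∘ signedPowResolvent r β`. -/
lemma exists_signedPow_resolvent_sub_eq (hr : 1 ≤ r) (hβ : 0 ≤ β) (u v : ℝ) :
    ∃ ξ ∈ Set.uIcc (signedPowResolvent r β u) (signedPowResolvent r β v),
      signedPow r (signedPowResolvent r β u) - signedPow r (signedPowResolvent r β v) =
        r * |ξ| ^ (r - 1) / (1 + β * (r * |ξ| ^ (r - 1))) * (u - v) := by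
  obtain ⟨ξ, hξ, h⟩ := exists_signedPow_sub_eq hr (signedPowResolvent r β u)
    (signedPowResolvent r β v)
  refine ⟨ξ, hξ, ?_⟩
  have hu := signedPowResolvent_spec hr hβ u
  have hv := signedPowResolvent_spec hr hβ v
  set x := signedPowResolvent r β u
  set y := signedPowResolvent r β v
  have hd : 0 ≤ β * (r * |ξ| ^ (r - 1)) := by positivity
  have e : u - v = (1 + β * (r * |ξ| ^ (r - 1))) * (x - y) := by
    rw [← hu, ← hv]; linear_combination β * h
  rw [h, e]
  have : 1 + β * (r * |ξ| ^ (r - 1)) ≠ 0 := by linarith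
  field_simp

lemma abs_signedPow_resolvent_sub_le (hr : 1 ≤ r) (hβ : 0 ≤ β) {u v R : ℝ}
    (hu : |u| ≤ R) (hv : |v| ≤ R) :
    |signedPow r (signedPowResolvent r β u) - signedPow r (signedPowResolvent r β v)| ≤
      r * R ^ (r - 1) * |u - v| := by
  obtain ⟨ξ, hξ, h⟩ := exists_signedPow_resolvent_sub_eq hr hβ u v
  have hξR : |ξ| ≤ R := by
    have h1 := abs_le.1 ((abs_signedPowResolvent_le hr hβ u).trans hu)
    have h2 := abs_le.1 ((abs_signedPowResolvent_le hr hβ v).trans hv)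
    exact abs_le.2 (Set.uIcc_subset_Icc (Set.mem_Icc.2 h1) (Set.mem_Icc.2 h2) hξ)
  rw [h, abs_mul]
  refine mul_le_mul_of_nonneg_right ?_ (abs_nonneg _)
  have hd : 0 ≤ r * |ξ| ^ (r - 1) := by positivity
  rw [abs_of_nonneg (by positivity)]
  refine (div_le_self hd (by nlinarith)).trans ?_
  gcongr

lemma abs_mul_signedPow_resolvent_sub_le (hr : 1 ≤ r) (hβ : 0 ≤ β) (u v : ℝ) :
    |β * signedPow r (signedPowResolvent r β u) - β * signedPow r (signedPowResolvent r β v)| ≤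
      |u - v| := by
  obtain ⟨ξ, hξ, h⟩ := exists_signedPow_resolvent_sub_eq hr hβ u v
  rw [← mul_sub, h, ← mul_assoc, abs_mul]
  refine mul_le_of_le_one_left (abs_nonneg _) ?_
  have hd : 0 ≤ β * (r * |ξ| ^ (r - 1)) := by positivity
  rw [← mul_div_assoc, abs_of_nonneg (by positivity), div_le_one (by positivity)]
  linarith

lemma le_mul_signedPow_resolvent (hr : 1 ≤ r) {β₀ u : ℝ} (hβ₀ : 0 ≤ β₀) (hβ : β₀ ≤ β)
    (hu : 1 ≤ u) :
    min (β₀ * signedPow r (1 / 2)) (1 / 2) ≤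
      β * signedPow r (signedPowResolvent r β u) := by
  have hs := signedPowResolvent_spec hr (hβ₀.trans hβ) u
  have h0 : 0 ≤ signedPow r (1 / 2) := mul_nonneg (by norm_num) (by positivity)
  rcases le_total (signedPowResolvent r β u) (1 / 2) with h | h
  · exact (min_le_right _ _).trans (by linarith)
  · exact (min_le_left _ _).trans
      (mul_le_mul hβ (monotone_signedPow hr h) h0 (hβ₀.trans hβ))

end Resolvent

section Limits

variable {ι : Type*} {l : Filter ι} {r : ℝ}

lemma tendsto_signedPowResolvent (hr : 1 ≤ r) {β u : ι → ℝ} {u₀ : ℝ}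
    (hβ : ∀ᶠ i in l, 0 ≤ β i) (hβ0 : Tendsto β l (nhds 0)) (hu : Tendsto u l (nhds u₀)) :
    Tendsto (fun i => signedPowResolvent r (β i) (u i)) l (nhds u₀) := by
  have h1 : Tendsto (fun i => β i * |u i| ^ r) l (nhds 0) := by
    simpa using hβ0.mul (hu.abs.rpow_const (Or.inr (by linarith : 0 ≤ r)))
  have h2 : Tendsto (fun i => signedPowResolvent r (β i) (u i) - u i) l (nhds 0) :=
    squeeze_zero_norm' (hβ.mono fun i hi => abs_signedPowResolvent_sub_self_le hr hi (u i)) h1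
  simpa using h2.add hu

lemma tendsto_signedPow_resolvent_quotient (hr : 1 ≤ r) {β τ : ι → ℝ}
    (hβ : ∀ᶠ i in l, 0 ≤ β i) (hβ0 : Tendsto β l (nhds 0)) (hτ : Tendsto τ l atTop) (b z : ℝ) :
    Tendsto (fun i => τ i * (signedPow r (signedPowResolvent r (β i) (b / τ i + z)) -
      signedPow r (signedPowResolvent r (β i) z))) l (nhds (r * |z| ^ (r - 1) * b)) := by
  have hu : Tendsto (fun i => b / τ i + z) l (nhds z) := by
    simpa using (tendsto_const_nhds.div_atTop hτ).add_const z
  have hx := tendsto_signedPowResolvent hr hβ hβ0 hu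
  have hy := tendsto_signedPowResolvent hr hβ hβ0 (tendsto_const_nhds (x := z))
  have hex : ∀ i, ∃ ξ, 0 ≤ β i → (ξ ∈ Set.uIcc (signedPowResolvent r (β i) (b / τ i + z))
      (signedPowResolvent r (β i) z) ∧
      signedPow r (signedPowResolvent r (β i) (b / τ i + z)) -
        signedPow r (signedPowResolvent r (β i) z) =
        r * |ξ| ^ (r - 1) / (1 + β i * (r * |ξ| ^ (r - 1))) * (b / τ i + z - z)) := by
    intro i
    by_cases hi : 0 ≤ β i
    · obtain ⟨ξ, h⟩ := exists_signedPow_resolvent_sub_eq hr hi (b / τ i + z) z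
      exact ⟨ξ, fun _ => h⟩
    · exact ⟨0, fun h => absurd h hi⟩
  choose ξ hξ using hex
  have hξz : Tendsto ξ l (nhds z) := by
    refine tendsto_of_tendsto_of_tendsto_of_le_of_le' (by simpa using hx.min hy)
      (by simpa using hx.max hy) ?_ ?_
    · filter_upwards [hβ] with i hi using (hξ i hi).1.1
    · filter_upwards [hβ] with i hi using (hξ i hi).1.2
  have hd : Tendsto (fun i => r * |ξ i| ^ (r - 1)) l (nhds (r * |z| ^ (r - 1))) :=
    (hξz.abs.rpow_const (Or.inr (by linarith))).const_mul r
  have hlim : Tendsto (fun i => r * |ξ i| ^ (r - 1) / (1 + β i * (r * |ξ i| ^ (r - 1))) * b) l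
      (nhds (r * |z| ^ (r - 1) * b)) := by
    simpa using (hd.div ((hβ0.mul hd).const_add 1) (by simp)).mul_const b
  refine hlim.congr' ?_
  filter_upwards [hβ, hτ.eventually_gt_atTop 0] with i hi hτi
  rw [(hξ i hi).2]
  field_simp
  ring

end Limits

section Prox

lemma prox_eq_of_subgradient {q χ u z : ℝ}
    (h : ∀ x, χ * |z| ^ q + (u - z) * (x - z) ≤ χ * |x| ^ q) : prox q χ u = z := by
  have hz : ∀ w, 1 / 2 * (u - z) ^ 2 + χ * |z| ^ q + 1 / 2 * (w - z) ^ 2 ≤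
      1 / 2 * (u - w) ^ 2 + χ * |w| ^ q := fun w => by nlinarith [h w]
  have hp := Classical.epsilon_spec (p := fun z : ℝ =>
    ∀ w : ℝ, (1 / 2) * (u - z) ^ 2 + χ * |z| ^ q ≤ (1 / 2) * (u - w) ^ 2 + χ * |w| ^ q)
    ⟨z, fun w => by nlinarith [hz w, sq_nonneg (w - z)]⟩
  change ∀ w : ℝ, (1 / 2) * (u - prox q χ u) ^ 2 + χ * |prox q χ u| ^ q ≤
    (1 / 2) * (u - w) ^ 2 + χ * |w| ^ q at hp
  have h0 : (prox q χ u - z) ^ 2 = 0 :=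
    le_antisymm (by linarith [hp z, hz (prox q χ u)]) (sq_nonneg _)
  exact sub_eq_zero.1 (pow_eq_zero_iff two_ne_zero |>.1 h0)

lemma mul_rpow_sub_one_mul_le {q s t : ℝ} (hq : 1 < q) (hs : 0 ≤ s) (ht : 0 ≤ t) :
    q * t ^ (q - 1) * s ≤ s ^ q + (q - 1) * t ^ q := by
  have hconj : q.HolderConjugate (q / (q - 1)) := Real.HolderConjugate.conjExponent hq
  have h := Real.young_inequality_of_nonneg hs (Real.rpow_nonneg ht (q - 1)) hconj
  have hq1 : q - 1 ≠ 0 := by linarith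
  have e : (t ^ (q - 1)) ^ (q / (q - 1)) = t ^ q := by
    rw [← Real.rpow_mul ht]; congr 1; field_simp
  rw [e] at h
  have h' := mul_le_mul_of_nonneg_left h (by linarith : 0 ≤ q)
  have e2 : q * (s ^ q / q + t ^ q / (q / (q - 1))) = s ^ q + (q - 1) * t ^ q := by
    field_simp
  linarith

lemma prox_eq_signedPow_resolvent {q α β τ : ℝ} (hq : 1 < q) (hq2 : q ≤ 2) (hα : 0 < α)
    (hβ : 0 < β) (hαβ : α * q * β ^ (q - 1) = 1) (hτ : 0 < τ) (v : ℝ) :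
    prox q (α * τ ^ (2 - q)) (τ * v) =
      τ * (β * signedPow (1 / (q - 1)) (signedPowResolvent (1 / (q - 1)) β v)) := by
  have hq1 : 0 < q - 1 := by linarith
  have hr : 1 ≤ 1 / (q - 1) := by rw [le_div_iff₀ hq1]; linarith
  have hs := signedPowResolvent_spec hr hβ.le v
  set w := signedPowResolvent (1 / (q - 1)) β v
  set z := τ * (β * signedPow (1 / (q - 1)) w) with hz
  have hp : τ * v - z = τ * w := by rw [hz]; linear_combination -τ * hs
  have hzabs : |z| = τ * β * |w| ^ (1 / (q - 1)) := by
    rw [hz, abs_mul, abs_mul, abs_signedPow hr, abs_of_pos hτ, abs_of_pos hβ]; ring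
  have hzpow : |z| ^ (q - 1) = τ ^ (q - 1) * β ^ (q - 1) * |w| := by
    rw [hzabs, Real.mul_rpow (by positivity) (by positivity), Real.mul_rpow hτ.le hβ.le,
      ← Real.rpow_mul (abs_nonneg w), one_div_mul_cancel hq1.ne', Real.rpow_one]
  have hττ : τ ^ (2 - q) * τ ^ (q - 1) = τ := by
    rw [← Real.rpow_add hτ]; ring_nf; simp
  have hpabs : τ * |w| = α * τ ^ (2 - q) * (q * |z| ^ (q - 1)) := by
    rw [hzpow]
    calc τ * |w| = τ * |w| * (α * q * β ^ (q - 1)) := by rw [hαβ, mul_one]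
      _ = (τ ^ (2 - q) * τ ^ (q - 1)) * |w| * (α * q * β ^ (q - 1)) := by rw [hττ]
      _ = _ := by ring
  have hwz : τ * w * z = τ * |w| * |z| := by
    have : 0 ≤ w * z := by
      have : w * z = τ * β * |w| ^ (1 / (q - 1) - 1) * (w * w) := by
        rw [hz, signedPow]; ring
      rw [this]
      exact mul_nonneg (by positivity) (mul_self_nonneg w)
    rw [mul_assoc, mul_assoc, ← abs_mul, abs_of_nonneg this]
  have hzq : |z| ^ (q - 1) * |z| = |z| ^ q := by
    rcases eq_or_ne |z| 0 with h0 | h0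
    · rw [h0, Real.zero_rpow (by linarith : q ≠ 0), mul_zero]
    · rw [Real.rpow_sub_one h0]; field_simp
  refine prox_eq_of_subgradient fun x => ?_
  have hχ : 0 ≤ α * τ ^ (2 - q) := by positivity
  have hy := mul_le_mul_of_nonneg_left
    (mul_rpow_sub_one_mul_le hq (abs_nonneg x) (abs_nonneg z)) hχ
  have hwx : τ * w * x ≤ τ * |w| * |x| := by
    rw [mul_assoc, mul_assoc, ← abs_mul]
    exact mul_le_mul_of_nonneg_left (le_abs_self _) hτ.le
  have hwz' : τ * w * z = α * τ ^ (2 - q) * (q * |z| ^ q) := by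
    rw [hwz, hpabs, ← hzq]; ring
  rw [hpabs] at hwx
  rw [hp, mul_sub]
  linarith

end Prox

section Moments

variable {μ : Measure ℝ} [IsProbabilityMeasure μ]

lemma memLp_id_of_integrable_abs_pow (hm : ∀ k : ℕ, 1 ≤ k → Integrable (fun x => |x| ^ k) μ)
    {p : ENNReal} (hp : p ≠ ⊤) : MemLp (id : ℝ → ℝ) p μ := by
  obtain ⟨k, hk⟩ := ENNReal.exists_nat_gt hp
  have hk1 : MemLp (id : ℝ → ℝ) ((k + 1 : ℕ) : ENNReal) μ := by
    refine (integrable_norm_rpow_iff aestronglyMeasurable_id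
      (by simp) (ENNReal.natCast_ne_top _)).1 ?_
    refine (hm (k + 1) (by omega)).congr (ae_of_all _ fun x => ?_)
    simp only [id, Real.norm_eq_abs, ENNReal.toReal_natCast, Real.rpow_natCast]
  exact hk1.mono_exponent (hk.le.trans (by exact_mod_cast Nat.le_succ k))

lemma memLp_radius (hm : ∀ k : ℕ, 1 ≤ k → Integrable (fun x => |x| ^ k) μ)
    {p : ENNReal} (hp : p ≠ ⊤) : MemLp (fun x : ℝ × ℝ => |x.1| + |x.2|) p (μ.prod (gaussianReal 0 1)) := by
  lift p to NNReal using hp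
  have h1 := ((memLp_id_of_integrable_abs_pow hm (p := p) ENNReal.coe_ne_top).norm).comp_fst
    (gaussianReal 0 1)
  have h2 := ((memLp_id_gaussianReal (μ := 0) (v := 1) p).norm).comp_snd μ
  exact h1.add h2

lemma integrable_radius_rpow (hm : ∀ k : ℕ, 1 ≤ k → Integrable (fun x => |x| ^ k) μ)
    {a : ℝ} (ha : 0 ≤ a) : Integrable (fun x : ℝ × ℝ => (|x.1| + |x.2|) ^ a) (μ.prod (gaussianReal 0 1)) := by
  have h := (memLp_radius hm (p := ENNReal.ofReal a) ENNReal.ofReal_ne_top).integrable_norm_rpow'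
  refine h.congr (ae_of_all _ fun x => ?_)
  simp only [ENNReal.toReal_ofReal ha]
  rw [Real.norm_of_nonneg (by positivity)]


/-- The bridge estimate of `B` from `B + τZ` in units of `τβ`, where `α q = β ^ (1 - q)`. -/
noncomputable def scaledFit (r β τ : ℝ) (x : ℝ × ℝ) : ℝ :=
  signedPow r (signedPowResolvent r β (x.1 / τ + x.2))

/-- The second moment of the scaled estimate. -/
noncomputable def fitSq (μ : Measure ℝ) (r β τ : ℝ) : ℝ :=
  ∫ x, scaledFit r β τ x ^ 2 ∂(μ.prod (gaussianReal 0 1))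

/-- The correlation of `B` with the scaled estimate, centred at the pure-noise estimate. -/
noncomputable def fitCorr (μ : Measure ℝ) (r β τ : ℝ) : ℝ :=
  ∫ x, x.1 * (τ * (scaledFit r β τ x - scaledFit r β τ (0, x.2))) ∂(μ.prod (gaussianReal 0 1))

variable {r β τ : ℝ}

lemma continuous_scaledFit (hr : 1 ≤ r) (hβ : 0 ≤ β) : Continuous (scaledFit r β τ) :=
  (continuous_signedPow hr).comp ((continuous_signedPowResolvent hr hβ).comp (by fun_prop))

lemma continuous_scaledFit_noise (hr : 1 ≤ r) (hβ : 0 ≤ β) :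
    Continuous fun x : ℝ × ℝ => scaledFit r β τ (0, x.2) :=
  (continuous_scaledFit hr hβ).comp (by fun_prop)

lemma abs_div_add_le (hτ : 1 ≤ τ) (x : ℝ × ℝ) : |x.1 / τ + x.2| ≤ |x.1| + |x.2| := by
  refine (abs_add_le _ _).trans (add_le_add_left ?_ _)
  rw [abs_div, abs_of_pos (by linarith : 0 < τ)]
  exact div_le_self (abs_nonneg _) hτ

lemma abs_scaledFit_le (hr : 1 ≤ r) (hβ : 0 ≤ β) (hτ : 1 ≤ τ) (x : ℝ × ℝ) :
    |scaledFit r β τ x| ≤ (|x.1| + |x.2|) ^ r :=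
  (abs_signedPow_resolvent_le hr hβ _).trans
    (Real.rpow_le_rpow (abs_nonneg _) (abs_div_add_le hτ x) (by linarith))

lemma scaledFit_sq_le (hr : 1 ≤ r) (hβ : 0 ≤ β) (hτ : 1 ≤ τ) (x : ℝ × ℝ) :
    scaledFit r β τ x ^ 2 ≤ (|x.1| + |x.2|) ^ (2 * r) := by
  rw [← sq_abs, mul_comm, Real.rpow_mul (by positivity), Real.rpow_two]
  exact pow_le_pow_left₀ (abs_nonneg _) (abs_scaledFit_le hr hβ hτ x) 2

lemma memLp_two_scaledFit (hm : ∀ k : ℕ, 1 ≤ k → Integrable (fun x => |x| ^ k) μ)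
    (hr : 1 ≤ r) (hβ : 0 ≤ β) (hτ : 1 ≤ τ) : MemLp (scaledFit r β τ) 2 (μ.prod (gaussianReal 0 1)) := by
  have hc := continuous_scaledFit (τ := τ) hr hβ
  refine (memLp_two_iff_integrable_sq hc.aestronglyMeasurable).2 ?_
  refine (integrable_radius_rpow hm (a := 2 * r) (by linarith)).mono'
    (hc.pow 2).aestronglyMeasurable (ae_of_all _ fun x => ?_)
  rw [Real.norm_of_nonneg (sq_nonneg _)]
  exact scaledFit_sq_le hr hβ hτ x

lemma memLp_two_scaledFit_noise (hm : ∀ k : ℕ, 1 ≤ k → Integrable (fun x => |x| ^ k) μ)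
    (hr : 1 ≤ r) (hβ : 0 ≤ β) (hτ : 1 ≤ τ) :
    MemLp (fun x : ℝ × ℝ => scaledFit r β τ (0, x.2)) 2 (μ.prod (gaussianReal 0 1)) := by
  have hc := continuous_scaledFit_noise (τ := τ) hr hβ
  refine (memLp_two_iff_integrable_sq hc.aestronglyMeasurable).2 ?_
  refine (integrable_radius_rpow hm (a := 2 * r) (by linarith)).mono'
    (hc.pow 2).aestronglyMeasurable (ae_of_all _ fun x => ?_)
  rw [Real.norm_of_nonneg (sq_nonneg _)]
  refine (scaledFit_sq_le hr hβ hτ _).trans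
    (Real.rpow_le_rpow (by positivity) ?_ (by linarith))
  simp

lemma integral_scaledFit_noise (hr : 1 ≤ r) (hβ : 0 ≤ β) :
    ∫ z, scaledFit r β τ (0, z) ∂(gaussianReal 0 1) = 0 := by
  have h : ∫ z, scaledFit r β τ (0, z) ∂(gaussianReal 0 1) =
      ∫ z, scaledFit r β τ (0, -z) ∂(gaussianReal 0 1) := by
    have hmap := gaussianReal_map_neg (μ := 0) (v := 1)
    rw [neg_zero] at hmap
    have hc : Continuous fun z : ℝ => scaledFit r β τ (0, z) :=
      (continuous_scaledFit hr hβ).comp (by fun_prop)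
    conv_lhs => rw [← hmap]
    exact integral_map (by fun_prop) hc.aestronglyMeasurable
  have hodd : ∀ z, scaledFit r β τ (0, -z) = -scaledFit r β τ (0, z) := fun z => by
    simp only [scaledFit, zero_div, zero_add, signedPowResolvent_neg hr hβ, signedPow_neg]
  simp only [hodd, integral_neg] at h
  linarith

lemma integral_fst_mul_scaledFit (hm : ∀ k : ℕ, 1 ≤ k → Integrable (fun x => |x| ^ k) μ)
    (hr : 1 ≤ r) (hβ : 0 ≤ β) (hτ : 1 ≤ τ) :
    (∫ x, x.1 * scaledFit r β τ x ∂(μ.prod (gaussianReal 0 1))) * τ = fitCorr μ r β τ := by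
  have hb : MemLp (fun x : ℝ × ℝ => x.1) 2 (μ.prod (gaussianReal 0 1)) :=
    (memLp_id_of_integrable_abs_pow hm (p := 2) (by simp)).comp_fst _
  have h1 : Integrable (fun x : ℝ × ℝ => x.1 * scaledFit r β τ x) (μ.prod (gaussianReal 0 1)) :=
    hb.integrable_mul (memLp_two_scaledFit hm hr hβ hτ)
  have h2 : Integrable (fun x : ℝ × ℝ => x.1 * scaledFit r β τ (0, x.2)) (μ.prod (gaussianReal 0 1)) :=
    hb.integrable_mul (memLp_two_scaledFit_noise hm hr hβ hτ)
  have h0 : ∫ x : ℝ × ℝ, x.1 * scaledFit r β τ (0, x.2) ∂(μ.prod (gaussianReal 0 1)) = 0 := by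
    rw [integral_prod_mul (fun b : ℝ => b) (fun z => scaledFit r β τ (0, z)),
      integral_scaledFit_noise hr hβ, mul_zero]
  calc (∫ x, x.1 * scaledFit r β τ x ∂(μ.prod (gaussianReal 0 1))) * τ
      = (∫ x, x.1 * scaledFit r β τ x ∂(μ.prod (gaussianReal 0 1)) -
          ∫ x : ℝ × ℝ, x.1 * scaledFit r β τ (0, x.2) ∂(μ.prod (gaussianReal 0 1))) * τ := by rw [h0, sub_zero]
    _ = fitCorr μ r β τ := by
        rw [← integral_sub h1 h2, ← integral_mul_const, fitCorr]
        congr 1; funext x; ring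

lemma mse_eq {q α : ℝ} (hm : ∀ k : ℕ, 1 ≤ k → Integrable (fun x => |x| ^ k) μ)
    (hq : 1 < q) (hq2 : q ≤ 2) (hα : 0 < α) (hβ : 0 < β) (hαβ : α * q * β ^ (q - 1) = 1)
    (hτ : 1 ≤ τ) :
    mse q μ α τ = ∫ x, x ^ 2 ∂μ + τ ^ 2 * β ^ 2 * fitSq μ (1 / (q - 1)) β τ -
      2 * β * fitCorr μ (1 / (q - 1)) β τ := by
  have hq1 : 0 < q - 1 := by linarith
  have hr : 1 ≤ 1 / (q - 1) := by rw [le_div_iff₀ hq1]; linarith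
  have hτ0 : 0 < τ := by linarith
  set r := 1 / (q - 1) with hrdef
  have hb : MemLp (fun x : ℝ × ℝ => x.1) 2 (μ.prod (gaussianReal 0 1)) :=
    (memLp_id_of_integrable_abs_pow hm (p := 2) (by simp)).comp_fst _
  have hf := memLp_two_scaledFit hm hr hβ.le hτ
  have hbf : Integrable (fun x : ℝ × ℝ => x.1 * scaledFit r β τ x) (μ.prod (gaussianReal 0 1)) :=
    hb.integrable_mul hf
  have hd : MemLp (fun x : ℝ × ℝ => τ * β * scaledFit r β τ x - x.1) 2 (μ.prod (gaussianReal 0 1)) :=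
    (hf.const_mul (τ * β)).sub hb
  have hprox : ∀ b z : ℝ, prox q (α * τ ^ (2 - q)) (b + τ * z) =
      τ * β * scaledFit r β τ (b, z) := fun b z => by
    have : b + τ * z = τ * (b / τ + z) := by field_simp
    rw [this, prox_eq_signedPow_resolvent hq hq2 hα hβ hαβ hτ0, scaledFit, ← hrdef, mul_assoc]
  have hfst : ∫ x : ℝ × ℝ, x.1 ^ 2 ∂(μ.prod (gaussianReal 0 1)) = ∫ x, x ^ 2 ∂μ := by
    rw [integral_fun_fst (fun b : ℝ => b ^ 2)]; simp
  calc mse q μ α τ = ∫ b, ∫ z, (τ * β * scaledFit r β τ (b, z) - b) ^ 2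
        ∂(gaussianReal 0 1) ∂μ := by simp only [mse, hprox]
    _ = ∫ x : ℝ × ℝ, (τ * β * scaledFit r β τ x - x.1) ^ 2 ∂(μ.prod (gaussianReal 0 1)) :=
        (integral_prod _ hd.integrable_sq).symm
    _ = ∫ x : ℝ × ℝ, (x.1 ^ 2 + τ ^ 2 * β ^ 2 * scaledFit r β τ x ^ 2 -
          2 * β * τ * (x.1 * scaledFit r β τ x)) ∂(μ.prod (gaussianReal 0 1)) := by
        congr 1; funext x; ring
    _ = _ := by
        have h1 : Integrable (fun x : ℝ × ℝ => x.1 ^ 2 + τ ^ 2 * β ^ 2 * scaledFit r β τ x ^ 2)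
            (μ.prod (gaussianReal 0 1)) := hb.integrable_sq.add (hf.integrable_sq.const_mul _)
        rw [integral_sub h1 (hbf.const_mul _), integral_add hb.integrable_sq
          (hf.integrable_sq.const_mul _), integral_const_mul, integral_const_mul, hfst,
          ← integral_fst_mul_scaledFit hm hr hβ.le hτ, fitSq]
        ring

lemma mul_fitCorr_le (hm : ∀ k : ℕ, 1 ≤ k → Integrable (fun x => |x| ^ k) μ)
    (hr : 1 ≤ r) (hβ : 0 ≤ β) (hτ : 0 < τ) : β * fitCorr μ r β τ ≤ ∫ x, x ^ 2 ∂μ := by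
  have hb : MemLp (fun x : ℝ × ℝ => x.1) 2 (μ.prod (gaussianReal 0 1)) :=
    (memLp_id_of_integrable_abs_pow hm (p := 2) (by simp)).comp_fst _
  have hfst : ∫ x : ℝ × ℝ, x.1 ^ 2 ∂(μ.prod (gaussianReal 0 1)) = ∫ x, x ^ 2 ∂μ := by
    rw [integral_fun_fst (fun b : ℝ => b ^ 2)]; simp
  rw [fitCorr, ← integral_const_mul, ← hfst]
  refine (Real.le_norm_self _).trans (norm_integral_le_of_norm_le hb.integrable_sq
    (ae_of_all _ fun x => ?_))
  have h := abs_mul_signedPow_resolvent_sub_le hr hβ (x.1 / τ + x.2) (0 / τ + x.2)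
  have hsub : |x.1 / τ + x.2 - (0 / τ + x.2)| = |x.1| / τ := by
    rw [← abs_of_pos hτ, ← abs_div, abs_of_pos hτ]; congr 1; ring
  rw [hsub, ← mul_sub] at h
  calc ‖β * (x.1 * (τ * (scaledFit r β τ x - scaledFit r β τ (0, x.2))))‖
      = |x.1| * (τ * |β * (scaledFit r β τ x - scaledFit r β τ (0, x.2))|) := by
        simp only [Real.norm_eq_abs, abs_mul, abs_of_pos hτ]; ring
    _ ≤ |x.1| * (τ * (|x.1| / τ)) := by gcongr; exact h
    _ = x.1 ^ 2 := by rw [← sq_abs x.1]; field_simp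

lemma le_sq_mul_fitSq (hm : ∀ k : ℕ, 1 ≤ k → Integrable (fun x => |x| ^ k) μ)
    (hr : 1 ≤ r) {β₀ : ℝ} (hβ₀ : 0 ≤ β₀) (hβ : β₀ ≤ β) (hτ : 1 ≤ τ) :
    min (β₀ * signedPow r (1 / 2)) (1 / 2) ^ 2 *
      (μ.real {0} * (gaussianReal 0 1).real (Set.Ici 1)) ≤ β ^ 2 * fitSq μ r β τ := by
  have hf := ((memLp_two_scaledFit hm hr (hβ₀.trans hβ) hτ).const_mul β).integrable_sq
  have h := mul_meas_ge_le_integral_of_nonneg (ae_of_all _ fun x => sq_nonneg _) hf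
    (min (β₀ * signedPow r (1 / 2)) (1 / 2) ^ 2)
  simp only [mul_pow] at h
  rw [integral_const_mul] at h
  refine le_trans (mul_le_mul_of_nonneg_left ?_ (sq_nonneg _)) h
  rw [← measureReal_prod_prod]
  refine measureReal_mono ?_
  rintro ⟨b, z⟩ ⟨hb, hz⟩
  have hb' : b = 0 := hb
  subst hb'
  have h0 : 0 ≤ signedPow r (1 / 2) := mul_nonneg (by norm_num) (by positivity)
  have := le_mul_signedPow_resolvent hr hβ₀ hβ (u := 0 / τ + z) (by simpa using hz)
  simp only [Set.mem_ofPred_eq]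
  rw [← mul_pow]
  exact pow_le_pow_left₀ (by positivity) this 2

lemma integrable_gaussian_abs_rpow {a : ℝ} (ha : 0 ≤ a) :
    Integrable (fun z : ℝ => |z| ^ a) (gaussianReal 0 1) := by
  have h := (memLp_id_gaussianReal (μ := 0) (v := 1) ⟨a, ha⟩).integrable_norm_rpow'
  exact h

lemma integral_gaussian_abs_rpow_pos {a : ℝ} (ha : 0 ≤ a) :
    0 < ∫ z : ℝ, |z| ^ a ∂(gaussianReal 0 1) := by
  rw [integral_pos_iff_support_of_nonneg (fun z => by positivity)
    (integrable_gaussian_abs_rpow ha)]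
  have := nullSingletonClass_gaussianReal (μ := 0) (v := 1) one_ne_zero
  have h1 : (gaussianReal 0 1) ({0}ᶜ : Set ℝ) = 1 := by
    rw [prob_compl_eq_one_iff (measurableSet_singleton _)]; simp
  refine lt_of_lt_of_le (by rw [h1]; exact one_pos) (measure_mono (μ := gaussianReal 0 1) ?_)
  intro z hz
  exact (Real.rpow_pos_of_pos (abs_pos.2 hz) a).ne'

variable {ι : Type*} {l : Filter ι} [l.IsCountablyGenerated]

lemma tendsto_fitSq (hm : ∀ k : ℕ, 1 ≤ k → Integrable (fun x => |x| ^ k) μ) (hr : 1 ≤ r)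
    {β τ : ι → ℝ} (hβ : ∀ᶠ i in l, 0 ≤ β i) (hβ0 : Tendsto β l (nhds 0))
    (hτ : Tendsto τ l atTop) :
    Tendsto (fun i => fitSq μ r (β i) (τ i)) l
      (nhds (∫ z, |z| ^ (2 * r) ∂(gaussianReal 0 1))) := by
  have hlim : ∫ z, |z| ^ (2 * r) ∂(gaussianReal 0 1) =
      ∫ x : ℝ × ℝ, signedPow r x.2 ^ 2 ∂(μ.prod (gaussianReal 0 1)) := by
    rw [integral_fun_snd (fun z => signedPow r z ^ 2)]
    simp only [probReal_univ, one_smul]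
    congr 1; funext z
    rw [← sq_abs (signedPow r z), abs_signedPow hr, mul_comm, Real.rpow_mul (abs_nonneg _),
      Real.rpow_two]
  rw [hlim]
  refine tendsto_integral_filter_of_dominated_convergence _ ?_ ?_
    (integrable_radius_rpow hm (a := 2 * r) (by linarith)) (ae_of_all _ fun x => ?_)
  · filter_upwards [hβ] with i hi
    exact ((continuous_scaledFit hr hi).pow 2).aestronglyMeasurable
  · filter_upwards [hβ, hτ.eventually_ge_atTop 1] with i hi hτi
    refine ae_of_all _ fun x => ?_
    rw [Real.norm_of_nonneg (sq_nonneg _)]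
    exact scaledFit_sq_le hr hi hτi x
  · have hu : Tendsto (fun i => x.1 / τ i + x.2) l (nhds x.2) := by
      simpa using (tendsto_const_nhds.div_atTop hτ).add_const x.2
    exact (((continuous_signedPow hr).tendsto _).comp
      (tendsto_signedPowResolvent hr hβ hβ0 hu)).pow 2

lemma tendsto_fitCorr (hm : ∀ k : ℕ, 1 ≤ k → Integrable (fun x => |x| ^ k) μ) (hr : 1 ≤ r)
    {β τ : ι → ℝ} (hβ : ∀ᶠ i in l, 0 ≤ β i) (hβ0 : Tendsto β l (nhds 0))
    (hτ : Tendsto τ l atTop) :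
    Tendsto (fun i => fitCorr μ r (β i) (τ i)) l
      (nhds ((∫ x, x ^ 2 ∂μ) * (r * ∫ z, |z| ^ (r - 1) ∂(gaussianReal 0 1)))) := by
  have hlim : (∫ x, x ^ 2 ∂μ) * (r * ∫ z, |z| ^ (r - 1) ∂(gaussianReal 0 1)) =
      ∫ x : ℝ × ℝ, x.1 * (r * |x.2| ^ (r - 1) * x.1) ∂(μ.prod (gaussianReal 0 1)) := by
    rw [← integral_const_mul, ← integral_prod_mul (fun b : ℝ => b ^ 2)]
    congr 1; funext x; ring
  rw [hlim]
  refine tendsto_integral_filter_of_dominated_convergence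
    (fun x => r * (|x.1| + |x.2|) ^ (r + 1)) ?_ ?_
    ((integrable_radius_rpow hm (a := r + 1) (by linarith)).const_mul r)
    (ae_of_all _ fun x => ?_)
  · filter_upwards [hβ] with i hi
    exact (continuous_fst.mul (continuous_const.mul ((continuous_scaledFit hr hi).sub
      (continuous_scaledFit_noise hr hi)))).aestronglyMeasurable
  · filter_upwards [hβ, hτ.eventually_ge_atTop 1] with i hi hτi
    refine ae_of_all _ fun x => ?_
    have hτ0 : 0 < τ i := by linarith
    have h := abs_signedPow_resolvent_sub_le hr hi (abs_div_add_le hτi x)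
      (v := 0 / τ i + x.2) (R := |x.1| + |x.2|) (by simp)
    have hsub : |x.1 / τ i + x.2 - (0 / τ i + x.2)| = |x.1| / τ i := by
      rw [← abs_of_pos hτ0, ← abs_div, abs_of_pos hτ0]; congr 1; ring
    rw [hsub] at h
    rw [Real.norm_eq_abs, abs_mul, abs_mul, abs_of_pos hτ0]
    have hg : 0 ≤ (|x.1| + |x.2|) := by positivity
    calc |x.1| * (τ i * |scaledFit r (β i) (τ i) x - scaledFit r (β i) (τ i) (0, x.2)|)
        ≤ |x.1| * (τ i * (r * (|x.1| + |x.2|) ^ (r - 1) * (|x.1| / τ i))) := by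
          gcongr; exact h
      _ = r * (|x.1| + |x.2|) ^ (r - 1) * (|x.1| * |x.1|) := by field_simp
      _ ≤ r * (|x.1| + |x.2|) ^ (r - 1) * ((|x.1| + |x.2|) * (|x.1| + |x.2|)) := by
          gcongr <;> simp
      _ = r * (|x.1| + |x.2|) ^ (r + 1) := by
          rw [mul_assoc, ← sq, ← Real.rpow_two, ← Real.rpow_add_of_nonneg hg (by linarith) two_pos.le]
          congr 2; ring
  · have h := (tendsto_signedPow_resolvent_quotient hr hβ hβ0 hτ x.1 x.2).const_mul x.1
    simpa [scaledFit] using h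

end Moments

lemma gaussianReal_real_Ici_one_pos : 0 < (gaussianReal 0 1).real (Set.Ici 1) := by
  refine ENNReal.toReal_pos (fun h => ?_) (measure_ne_top _ _)
  have := gaussianReal_absolutelyContinuous' 0 one_ne_zero h
  simp at this

lemma isProbabilityMeasure_mixLaw {ε : ℝ} (hε : ε ∈ Set.Ioo (0 : ℝ) 1) (pG : Measure ℝ)
    [IsProbabilityMeasure pG] : IsProbabilityMeasure (mixLaw ε pG) := by
  constructor
  simp only [mixLaw, Measure.add_apply, Measure.smul_apply, measure_univ, smul_eq_mul, mul_one]
  rw [← ENNReal.ofReal_add (by linarith [hε.2]) hε.1.le]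
  simp

lemma integrable_mixLaw {ε : ℝ} {pG : Measure ℝ} {f : ℝ → ℝ} (hf : Integrable f pG) :
    Integrable f (mixLaw ε pG) :=
  ((integrable_dirac (by simp)).smul_measure ENNReal.ofReal_ne_top).add_measure
    (hf.smul_measure ENNReal.ofReal_ne_top)

lemma integral_sq_mixLaw {ε : ℝ} (hε : 0 ≤ ε) {pG : Measure ℝ}
    (h : Integrable (fun x => x ^ 2) pG) :
    ∫ x, x ^ 2 ∂(mixLaw ε pG) = ε * ∫ x, x ^ 2 ∂pG := by
  rw [mixLaw, integral_add_measure
    ((integrable_dirac (by simp)).smul_measure ENNReal.ofReal_ne_top)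
    (h.smul_measure ENNReal.ofReal_ne_top), integral_smul_measure, integral_smul_measure]
  simp [ENNReal.toReal_ofReal hε]

lemma mixLaw_real_zero_pos {ε : ℝ} (hε : ε ∈ Set.Ioo (0 : ℝ) 1) (pG : Measure ℝ)
    [IsProbabilityMeasure pG] : 0 < (mixLaw ε pG).real {0} := by
  have := isProbabilityMeasure_mixLaw hε pG
  refine ENNReal.toReal_pos ?_ (measure_ne_top _ _)
  simp [mixLaw, hε.2]

lemma integral_sq_pos {pG : Measure ℝ} [IsProbabilityMeasure pG] (hG0 : pG {0} = 0)
    (h : Integrable (fun x => x ^ 2) pG) : 0 < ∫ x, x ^ 2 ∂pG := by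
  rw [integral_pos_iff_support_of_nonneg (fun x => sq_nonneg x) h]
  have h1 : pG ({0}ᶜ : Set ℝ) = 1 := by
    rw [prob_compl_eq_one_iff (measurableSet_singleton _)]; exact hG0
  refine lt_of_lt_of_le (by rw [h1]; exact one_pos) (measure_mono (μ := pG) ?_)
  intro z hz
  exact pow_ne_zero 2 hz

lemma neg_sq_div_le_of_pos {s v n : ℝ} (hv : 0 < v) : -(n ^ 2 / v) ≤ s ^ 2 * v - 2 * s * n := by
  have h : s ^ 2 * v - 2 * s * n + n ^ 2 / v = (s * v - n) ^ 2 / v := by field_simp; ring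
  have : 0 ≤ (s * v - n) ^ 2 / v := by positivity
  linarith

/-- Large-noise expansion of the optimal mean square error in terms of the effective noise
level `τ`. -/
theorem tendsto_sq_mul_mse_sub {q : ℝ} (hq1 : 1 < q) (hq2 : q ≤ 2) {μ : Measure ℝ}
    [IsProbabilityMeasure μ] (hm : ∀ k : ℕ, 1 ≤ k → Integrable (fun x => |x| ^ k) μ)
    (hμ0 : 0 < μ.real {0}) (hμ2 : 0 < ∫ x, x ^ 2 ∂μ) {ι : Type*} {l : Filter ι}
    [l.IsCountablyGenerated] {τ α : ι → ℝ} (hτ : Tendsto τ l atTop) (hα : ∀ᶠ i in l, 0 < α i)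
    (hmin : ∀ᶠ i in l, ∀ a : ℝ, 0 < a → mse q μ (α i) (τ i) ≤ mse q μ a (τ i)) :
    Tendsto (fun i => τ i ^ 2 * (mse q μ (α i) (τ i) - ∫ x, x ^ 2 ∂μ)) l
      (nhds (-((∫ x, x ^ 2 ∂μ) ^ 2 * cConst q))) := by
  have hq : 0 < q - 1 := by linarith
  set r := 1 / (q - 1) with hrdef
  have hr : 1 ≤ r := by rw [hrdef, le_div_iff₀ hq]; linarith
  set E := ∫ x, x ^ 2 ∂μ
  set M := ∫ z, |z| ^ (2 * r) ∂(gaussianReal 0 1) with hM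
  set m := ∫ z, |z| ^ (r - 1) ∂(gaussianReal 0 1) with hm_def
  have hMpos : 0 < M := integral_gaussian_abs_rpow_pos (by linarith)
  have hmpos : 0 < m := integral_gaussian_abs_rpow_pos (by linarith)
  set L := E * (r * m) with hL
  have hLpos : 0 < L := by positivity
  have hconst : E ^ 2 * cConst q = L ^ 2 / M := by
    have e1 : (2 - q) / (q - 1) = r - 1 := by rw [hrdef]; field_simp; ring
    have e2 : 2 / (q - 1) = 2 * r := by rw [hrdef]; ring
    rw [cConst, e1, e2, ← hM, ← hm_def, hL, hrdef]
    field_simp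
  rw [hconst]
  -- The tuning `a` corresponds to the shrinkage level `b` with `a q b ^ (q - 1) = 1`.
  have hmse : ∀ {a b t : ℝ}, 0 < a → 0 < b → a * q * b ^ (q - 1) = 1 → 1 ≤ t →
      t ^ 2 * (mse q μ a t - E) = (t ^ 2 * b) ^ 2 * fitSq μ r b t -
        2 * (t ^ 2 * b) * fitCorr μ r b t := fun ha hb hab ht => by
    rw [mse_eq hm hq1 hq2 ha hb hab ht]; ring
  have hτ1 : ∀ᶠ i in l, 1 ≤ τ i := hτ.eventually_ge_atTop 1
  have hτsq : Tendsto (fun i => τ i ^ 2) l atTop := (tendsto_pow_atTop two_ne_zero).comp hτ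
  -- A comparison tuning attaining the limit.
  have hcmp : Tendsto (fun i => τ i ^ 2 *
      (mse q μ (((L / M / τ i ^ 2) ^ (q - 1))⁻¹ / q) (τ i) - E)) l (nhds (-(L ^ 2 / M))) := by
    have hb0 : Tendsto (fun i => L / M / τ i ^ 2) l (nhds 0) := tendsto_const_nhds.div_atTop hτsq
    have hb : ∀ᶠ i in l, 0 ≤ L / M / τ i ^ 2 := Eventually.of_forall fun i => by positivity
    have h := ((tendsto_fitSq hm hr hb hb0 hτ).const_mul ((L / M) ^ 2)).sub
      ((tendsto_fitCorr hm hr hb hb0 hτ).const_mul (2 * (L / M)))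
    have e : (L / M) ^ 2 * M - 2 * (L / M) * L = -(L ^ 2 / M) := by field_simp; ring
    rw [← hM, ← hm_def, ← hL, e] at h
    refine h.congr' ?_
    filter_upwards [hτ1] with i hi
    have hτi : 0 < τ i := by linarith
    have hbi : 0 < L / M / τ i ^ 2 := by positivity
    have hpow := Real.rpow_pos_of_pos hbi (q - 1)
    rw [hmse (by positivity) hbi (by field_simp) hi]
    have : τ i ^ 2 * (L / M / τ i ^ 2) = L / M := by field_simp
    rw [this]
  have hle : ∀ᶠ i in l, τ i ^ 2 * (mse q μ (α i) (τ i) - E) ≤ τ i ^ 2 *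
      (mse q μ (((L / M / τ i ^ 2) ^ (q - 1))⁻¹ / q) (τ i) - E) := by
    filter_upwards [hmin, hτ1] with i hi hτi
    have hτ0 : 0 < τ i := by linarith
    have := hi (((L / M / τ i ^ 2) ^ (q - 1))⁻¹ / q) (by positivity)
    gcongr
  -- The shrinkage level of the optimal tuning.
  set β : ι → ℝ := fun i => (α i * q) ^ (-r) with hβdef
  have hβpos : ∀ᶠ i in l, 0 < β i := hα.mono fun i hi => by positivity
  have hαβ : ∀ᶠ i in l, α i * q * β i ^ (q - 1) = 1 := by
    filter_upwards [hα] with i hi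
    have h0 : 0 < α i * q := by positivity
    rw [hβdef]
    simp only
    rw [← Real.rpow_mul h0.le, neg_mul, hrdef, one_div_mul_cancel hq.ne', Real.rpow_neg_one,
      mul_inv_cancel₀ h0.ne']
  have hβ0 : Tendsto β l (nhds 0) := by
    refine tendsto_order.2 ⟨fun a ha => hβpos.mono fun i hi => ha.trans hi, fun β₀ hβ₀ => ?_⟩
    set κ := min (β₀ * signedPow r (1 / 2)) (1 / 2) ^ 2 *
      (μ.real {0} * (gaussianReal 0 1).real (Set.Ici 1))
    have hκ : 0 < κ := by
      have h1 : 0 < signedPow r (1 / 2) := mul_pos (by norm_num) (by positivity)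
      have h2 := gaussianReal_real_Ici_one_pos
      positivity
    have hneg := hcmp.eventually_lt_const (u := 0) (by
      have : 0 < L ^ 2 / M := by positivity
      linarith)
    filter_upwards [hle, hneg, hβpos, hαβ, hα, hτ1, hτsq.eventually_gt_atTop (2 * E / κ)]
      with i h1 h2 h3 h4 h5 h6 h7
    by_contra! hcon
    have hF := le_sq_mul_fitSq hm hr hβ₀.le hcon h6
    have hC := mul_fitCorr_le hm hr h3.le (by linarith : 0 < τ i)
    rw [hmse h5 h3 h4 h6] at h1
    have hτ2 : 0 < τ i ^ 2 := by positivity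
    have h8 : τ i ^ 2 * (τ i ^ 2 * (β i ^ 2 * fitSq μ r (β i) (τ i)) -
        2 * (β i * fitCorr μ r (β i) (τ i))) < 0 := by linarith
    have h9 := neg_of_mul_neg_right h8 hτ2.le
    have h10 : τ i ^ 2 * κ ≤ τ i ^ 2 * (β i ^ 2 * fitSq μ r (β i) (τ i)) := by gcongr
    rw [div_lt_iff₀ hκ] at h7
    linarith
  have hβnn : ∀ᶠ i in l, 0 ≤ β i := hβpos.mono fun i => le_of_lt
  have hv := tendsto_fitSq hm hr hβnn hβ0 hτ
  have hn := tendsto_fitCorr hm hr hβnn hβ0 hτ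
  have hlow : Tendsto (fun i => -(fitCorr μ r (β i) (τ i) ^ 2 / fitSq μ r (β i) (τ i))) l
      (nhds (-(L ^ 2 / M))) := ((hn.pow 2).div hv hMpos.ne').neg
  refine tendsto_of_tendsto_of_tendsto_of_le_of_le' hlow hcmp ?_ hle
  filter_upwards [hv.eventually_const_lt hMpos, hβpos, hαβ, hα, hτ1] with i h1 h2 h3 h4 h5
  rw [hmse h4 h2 h3 h5]
  exact neg_sq_div_le_of_pos h1

/-- **large noise expansion, `1 < q ≤ 2`.** Under the state-evolution
characterization of the optimally tuned bridge estimator, with `G ∼ p_G` having all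
moments finite and `p_G({0}) = 0`, the optimal `AMSE(σ) = E(η_q(B + τ(σ)Z; α(σ)τ(σ)^{2−q}) − B)²`
satisfies `σ²·(AMSE(σ) − ε·E G²) → −ε²·(E G²)²·c_q` as `σ → ∞`. -/
theorem stmt_18 (q δ ε : ℝ) (hq1 : 1 < q) (hq2 : q ≤ 2) (hδ : 0 < δ)
    (hε : ε ∈ Set.Ioo (0 : ℝ) 1)
    (pG : Measure ℝ) [IsProbabilityMeasure pG] (hG0 : pG {0} = 0)
    (hmom : ∀ k : ℕ, 1 ≤ k → Integrable (fun x => |x| ^ k) pG)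
    (τ α : ℝ → ℝ)
    (hτpos : ∀ σ : ℝ, 0 < σ → 0 < τ σ)
    (hαpos : ∀ σ : ℝ, 0 < σ → 0 < α σ)
    (hfix : ∀ σ : ℝ, 0 < σ →
      (τ σ) ^ 2 = σ ^ 2 + (1 / δ) * mse q (mixLaw ε pG) (α σ) (τ σ))
    (hmin : ∀ σ : ℝ, 0 < σ → ∀ a : ℝ, 0 < a →
      mse q (mixLaw ε pG) (α σ) (τ σ) ≤ mse q (mixLaw ε pG) a (τ σ)) :
    Tendsto
      (fun σ : ℝ =>
        σ ^ 2 * (mse q (mixLaw ε pG) (α σ) (τ σ) - ε * ∫ x, x ^ 2 ∂pG))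
      atTop
      (nhds (-(ε ^ 2 * (∫ x, x ^ 2 ∂pG) ^ 2 * cConst q))) := by
  have hsq : Integrable (fun x => x ^ 2) pG := by simpa using hmom 2 (by norm_num)
  have := isProbabilityMeasure_mixLaw hε pG
  set E := ε * ∫ x, x ^ 2 ∂pG
  have hE2 : ∫ x, x ^ 2 ∂(mixLaw ε pG) = E := integral_sq_mixLaw hε.1.le hsq
  have hmse : ∀ σ, 0 ≤ mse q (mixLaw ε pG) (α σ) (τ σ) := fun σ =>
    integral_nonneg fun b => integral_nonneg fun z => sq_nonneg _
  have hτ : Tendsto τ atTop atTop := by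
    refine tendsto_atTop_mono' atTop ?_ tendsto_id
    filter_upwards [eventually_gt_atTop 0] with σ hσ
    refine le_of_sq_le_sq ?_ (hτpos σ hσ).le
    have : 0 ≤ 1 / δ * mse q (mixLaw ε pG) (α σ) (τ σ) := mul_nonneg (by positivity) (hmse σ)
    simp only [id]
    linarith [hfix σ hσ]
  have hD := tendsto_sq_mul_mse_sub hq1 hq2
    (fun k hk => integrable_mixLaw (ε := ε) (hmom k hk)) (mixLaw_real_zero_pos hε pG)
    (by rw [hE2]; exact mul_pos hε.1 (integral_sq_pos hG0 hsq)) hτ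
    ((eventually_gt_atTop 0).mono hαpos) ((eventually_gt_atTop 0).mono hmin)
  rw [hE2] at hD
  have hτsq : Tendsto (fun σ => τ σ ^ 2) atTop atTop := (tendsto_pow_atTop two_ne_zero).comp hτ
  have hmseE : Tendsto (fun σ => mse q (mixLaw ε pG) (α σ) (τ σ) - E) atTop (nhds 0) := by
    refine (hD.div_atTop hτsq).congr' ?_
    filter_upwards [eventually_gt_atTop 0] with σ hσ
    have := (hτpos σ hσ).ne'
    field_simp
  have hratio : Tendsto (fun σ => 1 - 1 / δ * (mse q (mixLaw ε pG) (α σ) (τ σ) - E + E) / τ σ ^ 2)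
      atTop (nhds 1) := by
    simpa using (((hmseE.add_const E).const_mul (1 / δ)).div_atTop hτsq).const_sub 1
  have hlim := hratio.mul hD
  rw [one_mul, show E ^ 2 = ε ^ 2 * (∫ x, x ^ 2 ∂pG) ^ 2 from mul_pow _ _ _] at hlim
  refine hlim.congr' ?_
  filter_upwards [eventually_gt_atTop 0] with σ hσ
  have hτ0 := (hτpos σ hσ).ne'
  rw [sub_add_cancel, eq_sub_of_add_eq (hfix σ hσ).symm]
  field_simp
end
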